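/- arXiv:0805.1918 — 2 statements merged into one kernel-verified Lean document; each statement's English description precedes it below -/
import Mathlib

section
/- Convolution theorem: for f, g whose Grassmann coefficients are integrable functions on ℝ^m (and such that all coefficient convolutions exist), F^±_{m|2n}(f ∗ g) = (2π)^{M/2} · F^±_{m|2n}(f) · F^±_{m|2n}(g), where M = m − 2n. -/
open scoped BigOperators
open Finset MeasureTheory

noncomputable section

/-- The Grassmann algebra on `N` anticommuting generators with coefficients in a
commutative ring `R`, represented by its coefficients with respect to the basis of
increasingly-ordered monomials, indexed by subsets of the generators. -/
abbrev Gr (R : Type) (N : ℕ) : Type := Finset (Fin N) → R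

namespace Gr

variable {R : Type} [CommRing R] {N : ℕ}

/-- The sign produced when reordering the concatenation of the ordered monomials indexed
by `A` and `B` into the ordered monomial indexed by `A ∪ B`. -/
def msign (A B : Finset (Fin N)) : R :=
  (-1 : R) ^ (((A ×ˢ B).filter fun p => p.2 < p.1).card)

/-- Multiplication of the Grassmann algebra. -/
def mul (f g : Gr R N) : Gr R N :=
  fun s => ∑ A ∈ s.powerset, msign A (s \ A) * f A * g (s \ A)

/-- The unit of the Grassmann algebra. -/
def one : Gr R N := fun s => if s = (∅ : Finset (Fin N)) then 1 else 0

/-- The `j`-th generator of the Grassmann algebra. -/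
def gen (j : Fin N) : Gr R N := fun s => if s = {j} then 1 else 0

/-- Powers in the Grassmann algebra. -/
def pow (f : Gr R N) : ℕ → Gr R N
  | 0 => one
  | k + 1 => mul (pow f k) f

/-- The left partial derivative `∂_j`, i.e. the odd derivation with `∂_j(x_k) = δ_{jk}`. -/
def pderiv (j : Fin N) (f : Gr R N) : Gr R N :=
  fun s => if j ∈ s then 0
    else (-1 : R) ^ ((s.filter fun i => i < j).card) * f (insert j s)

/-- The exponential of a Grassmann algebra element with nilpotent (zero-constant-term)
argument: the series terminates, and all terms beyond degree `N` vanish. -/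
def gexp (f : Gr ℂ N) : Gr ℂ N :=
  ∑ k ∈ Finset.range (N + 1), ((k.factorial : ℂ))⁻¹ • pow f k

/-- Iterated left partial derivatives: the first element of the list acts first. -/
def derivList (l : List (Fin N)) (f : Gr R N) : Gr R N :=
  l.foldl (fun g j => pderiv j g) f

/-- Complex conjugation of the coefficients. -/
def gconj (f : Gr ℂ N) : Gr ℂ N := fun s => (starRingEnd ℂ) (f s)

end Gr

/-- The Lean index of the paper's generator `x`_{2j-1}` (j = 1,…,n). -/
def lo (n : ℕ) (j : Fin n) : Fin (2 * n) := ⟨2 * (j : ℕ), by have := j.isLt; omega⟩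

/-- The Lean index of the paper's generator `x`_{2j}` (j = 1,…,n). -/
def hi (n : ℕ) (j : Fin n) : Fin (2 * n) := ⟨2 * (j : ℕ) + 1, by have := j.isLt; omega⟩

/-- `x`² = Σ_{j=1}^n x`_{2j-1} x`_{2j}`. -/
def xsq (n : ℕ) : Gr ℂ (2 * n) := ∑ j : Fin n, Gr.mul (Gr.gen (lo n j)) (Gr.gen (hi n j))

/-- The fermionic Laplace operator `Δ_f = 4 Σ_{j=1}^n ∂_{x`_{2j-1}} ∂_{x`_{2j}}`. -/
def lapF (n : ℕ) (f : Gr ℂ (2 * n)) : Gr ℂ (2 * n) :=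
  (4 : ℂ) • ∑ j : Fin n, Gr.pderiv (lo n j) (Gr.pderiv (hi n j) f)

/-- The Berezin integral `∫_B = π^{-n} ∂_{x`_{2n}} ⋯ ∂_{x`_1}`. -/
def berezin (n : ℕ) (f : Gr ℂ (2 * n)) : ℂ :=
  ((Real.pi : ℂ) ^ n)⁻¹ * Gr.derivList (List.finRange (2 * n)) f ∅

/-- The fermionic Gaussian `exp(x`²/2) = Σ_{j=0}^n (x`²)^j/(2^j j!)`. -/
def fermGauss (n : ℕ) : Gr ℂ (2 * n) :=
  ∑ j ∈ Finset.range (n + 1), (((2 : ℂ) ^ j * j.factorial)⁻¹) • Gr.pow (xsq n) j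

/-- Embedding of the `x` generators into the Grassmann algebra on the `4n` generators
`x`_1, …, x`_{2n}, y`_1, …, y`_{2n}` (the `x` generators come first). -/
def xi (n : ℕ) (t : Fin (2 * n)) : Fin (2 * n + 2 * n) := Fin.castAdd (2 * n) t

/-- Embedding of the `y` generators into the Grassmann algebra on the `4n` generators. -/
def yi (n : ℕ) (t : Fin (2 * n)) : Fin (2 * n + 2 * n) := Fin.natAdd (2 * n) t

/-- The algebra embedding `Λ_{2n} → Λ_{4n}` sending the generators to the `x` generators. -/
def embX (n : ℕ) (f : Gr ℂ (2 * n)) : Gr ℂ (2 * n + 2 * n) :=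
  fun s => ∑ A : Finset (Fin (2 * n)), if s = A.image (xi n) then f A else 0

/-- The Berezin integral with respect to the `x` variables,
`π^{-n} ∂_{x`_{2n}} ⋯ ∂_{x`_1}`, inside the mixed algebra `Λ_{4n}`. -/
def berezinX (n : ℕ) (F : Gr ℂ (2 * n + 2 * n)) : Gr ℂ (2 * n + 2 * n) :=
  ((Real.pi : ℂ) ^ n)⁻¹ • Gr.derivList ((List.finRange (2 * n)).map (xi n)) F

/-- The fermionic Fourier kernel
`K^σ(x, y) = exp(-σ (i/2) Σ_{j=1}^n (x`_{2j-1} y`_{2j} - x`_{2j} y`_{2j-1}))`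
(for the plus sign `σ = 1`, for the minus sign `σ = -1`). -/
def fermK (n : ℕ) (σ : ℂ) : Gr ℂ (2 * n + 2 * n) :=
  Gr.gexp ((-σ * (Complex.I / 2)) • ∑ j : Fin n,
    (Gr.mul (Gr.gen (xi n (lo n j))) (Gr.gen (yi n (hi n j))) -
     Gr.mul (Gr.gen (xi n (hi n j))) (Gr.gen (yi n (lo n j)))))

/-- The fermionic Fourier transform
`F^σ_{0|2n}(g)(y) = (2π)^n ∫_{B,x} K^σ(x,y) g(x)`, an element of the Grassmann algebra
in the `y` variables, identified with `Λ_{2n}`. -/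
def fermFT (n : ℕ) (σ : ℂ) (g : Gr ℂ (2 * n)) : Gr ℂ (2 * n) :=
  fun s => (((2 * Real.pi : ℝ) : ℂ) ^ n) *
    berezinX n (Gr.mul (fermK n σ) (embX n g)) (s.image (yi n))


end
noncomputable section

/-- Functions on `ℝ^m` with values in the Grassmann algebra `Λ_{2n}`; the elements with
Schwartz coefficients form the space `S(ℝ^m)_{m|2n}`. -/
abbrev SF (m n : ℕ) : Type := ((Fin m) → ℝ) → Gr ℂ (2 * n)

/-- `f ∈ S(ℝ^m)_{m|2n}`: every Grassmann coefficient of `f` is a Schwartz function. -/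
def IsSchwartz (m n : ℕ) (f : SF m n) : Prop :=
  ∀ s : Finset (Fin (2 * n)), ∃ φ : SchwartzMap ((Fin m) → ℝ) ℂ, ∀ x, f x s = φ x

/-- The super Fourier transform
`F^σ_{m|2n}(f)(y) = (2π)^{-M/2} ∫_{ℝ^m} dV(x) ∫_{B,x} exp(σ i Σ_i x_i y_i) K^σ(x,y) f(x)`,
with `M = m - 2n` (plus sign: `σ = 1`; minus sign: `σ = -1`). -/
def superFT (m n : ℕ) (σ : ℂ) (f : SF m n) : SF m n :=
  fun y s => (((2 * Real.pi : ℝ) : ℂ) ^ ((-((m : ℂ) - 2 * (n : ℂ))) / 2)) *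
    ∫ x : (Fin m) → ℝ, Complex.exp (σ * Complex.I * ∑ i, (x i : ℂ) * (y i : ℂ)) *
      berezinX n (Gr.mul (fermK n σ) (embX n (f x))) (s.image (yi n))

/-- The partial derivative `∂_{x_i}` of a `Λ_{2n}`-valued function, acting coefficientwise. -/
def bderiv (m n : ℕ) (i : Fin m) (f : SF m n) : SF m n :=
  fun x s => fderiv ℝ (fun t => f t s) x (Pi.single i 1)

/-- The super Laplace operator `Δ = 4 Σ_j ∂_{x`_{2j-1}} ∂_{x`_{2j}} - Σ_j ∂_{x_j}²`. -/
def superLap (m n : ℕ) (f : SF m n) : SF m n :=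
  fun x => lapF n (f x) - ∑ i : Fin m, bderiv m n i (bderiv m n i f) x

/-- The element `x² = Σ_{j=1}^n x`_{2j-1} x`_{2j} - Σ_{j=1}^m x_j²` at the point `x`. -/
def xsqElem (m n : ℕ) (x : (Fin m) → ℝ) : Gr ℂ (2 * n) :=
  xsq n + (-(∑ i : Fin m, ((x i : ℂ)) ^ 2)) • Gr.one

/-- The super Gaussian `exp(x²/2) = exp(-(x_1²+⋯+x_m²)/2) Σ_{j=0}^n (x`²)^j/(2^j j!)`. -/
def gaussFun (m n : ℕ) : SF m n :=
  fun x => ((Real.exp (-(∑ i : Fin m, (x i) ^ 2) / 2) : ℝ) : ℂ) • fermGauss n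

/-- The Euler operator `𝔼 = Σ_j x_j ∂_{x_j} + Σ_j x`_j ∂_{x`_j}`. -/
def euler (m n : ℕ) (f : SF m n) : SF m n :=
  fun x => (∑ i : Fin m, ((x i : ℂ)) • bderiv m n i f x) +
    ∑ t : Fin (2 * n), Gr.mul (Gr.gen t) (Gr.pderiv t (f x))

/-- The super integral `∫_{ℝ^{m|2n}} f = ∫_{ℝ^m} dV(x) ∫_B f`. -/
def superInt (m n : ℕ) (f : SF m n) : ℂ := ∫ x : (Fin m) → ℝ, berezin n (f x)

end

noncomputable section

/-- The ordered monomial `η_{a_1} ⋯ η_{a_p}` (with `A = {a_1 < ⋯ < a_p}`) in the odd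
elements `η_j`. -/
def Gr.monom {N M : ℕ} (η : Fin N → Gr ℂ M) (A : Finset (Fin N)) : Gr ℂ M :=
  ((A.sort (· ≤ ·)).map η).foldr Gr.mul Gr.one

/-- Substitution of the odd elements `η_j` for the generators of `Λ_N`. -/
def Gr.subst {N M : ℕ} (η : Fin N → Gr ℂ M) (f : Gr ℂ N) : Gr ℂ M :=
  ∑ A : Finset (Fin N), f A • Gr.monom η A

/-- The convolution `f ∗ g(u) = ∫_{ℝ^{m|2n},x} f(u - x) g(x)`:  in the mixed Grassmann
algebra whose first block carries the integration variables `x`_j` and whose second block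
carries the variables `u`_j`, the Grassmann argument `u` - x`` is substituted into `f`
(via the finite Taylor expansion, i.e. the algebra morphism `x`_j ↦ u`_j - x`_j`), and
the Berezin integral is taken with respect to the `x`` variables. -/
def conv (m n : ℕ) (f g : SF m n) : SF m n :=
  fun u s => ∫ x : (Fin m) → ℝ,
    berezinX n (Gr.mul
      (Gr.subst (fun j => Gr.gen (yi n j) - Gr.gen (xi n j)) (f (u - x)))
      (embX n (g x))) (s.image (yi n))

namespace Gr

section Algebra

variable {R : Type} [CommRing R] {N : ℕ}

/-- The sign of moving the `j`-th generator past the generators of `s` that precede it. -/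
def sgn (j : Fin N) (s : Finset (Fin N)) : R := ∏ i ∈ s, if i < j then -1 else 1

/-- The ordered monomial indexed by `A`. -/
def basis (A : Finset (Fin N)) : Gr R N := Pi.single A 1

/-- The parity involution. -/
def parity (f : Gr R N) : Gr R N := fun s => (-1 : R) ^ s.card * f s

lemma sgn_eq (j : Fin N) (s : Finset (Fin N)) :
    (-1 : R) ^ (s.filter fun i => i < j).card = sgn j s := by
  simp [sgn, Finset.prod_ite]

lemma sgn_insert {i : Fin N} {s : Finset (Fin N)} (h : i ∉ s) (j : Fin N) :
    (sgn j (insert i s) : R) = (if i < j then -1 else 1) * sgn j s := by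
  simp [sgn, Finset.prod_insert h]

lemma sgn_insert_self {j : Fin N} {s : Finset (Fin N)} (h : j ∉ s) :
    (sgn j (insert j s) : R) = sgn j s := by
  simp [sgn_insert h]

lemma sgn_mul_self (j : Fin N) (s : Finset (Fin N)) : (sgn j s * sgn j s : R) = 1 := by
  rw [← sgn_eq, ← mul_pow]; simp

lemma msign_eq (A B : Finset (Fin N)) : (msign A B : R) = ∏ a ∈ A, sgn a B := by
  simp only [msign, sgn]
  rw [← Finset.prod_product', Finset.prod_ite]
  simp

lemma msign_insert {a : Fin N} {A : Finset (Fin N)} (h : a ∉ A) (B : Finset (Fin N)) :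
    (msign (insert a A) B : R) = sgn a B * msign A B := by
  simp [msign_eq, Finset.prod_insert h]

lemma pderiv_apply (j : Fin N) (f : Gr R N) (s : Finset (Fin N)) :
    pderiv j f s = if j ∈ s then 0 else sgn j s * f (insert j s) := by
  simp only [pderiv, sgn_eq]

lemma gen_mul_apply (j : Fin N) (f : Gr R N) (s : Finset (Fin N)) :
    mul (gen j) f s = if j ∈ s then sgn j s * f (s.erase j) else 0 := by
  by_cases h : j ∈ s
  · rw [mul, Finset.sum_eq_single {j}]
    · obtain ⟨t, ht, rfl⟩ : ∃ t, j ∉ t ∧ insert j t = s :=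
        ⟨s.erase j, by simp, Finset.insert_erase h⟩
      rw [Finset.sdiff_singleton_eq_erase, Finset.erase_insert ht, if_pos h, sgn_insert_self ht]
      simp [msign_eq, gen]
    · intro A _ hA
      simp [gen, hA]
    · intro hj
      simp [h] at hj
  · rw [if_neg h]
    refine Finset.sum_eq_zero fun A hA => ?_
    have : A ≠ {j} := by
      rintro rfl
      simp [h] at hA
    simp [gen, this]

lemma add_mul (f g h : Gr R N) : mul (f + g) h = mul f h + mul g h := by
  funext s
  simp only [mul, Pi.add_apply, ← Finset.sum_add_distrib]
  exact Finset.sum_congr rfl fun _ _ => by ring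

lemma mul_add (f g h : Gr R N) : mul f (g + h) = mul f g + mul f h := by
  funext s
  simp only [mul, Pi.add_apply, ← Finset.sum_add_distrib]
  exact Finset.sum_congr rfl fun _ _ => by ring

lemma smul_mul (c : R) (f g : Gr R N) : mul (c • f) g = c • mul f g := by
  funext s
  simp only [mul, Pi.smul_apply, smul_eq_mul, Finset.mul_sum]
  exact Finset.sum_congr rfl fun _ _ => by ring

lemma mul_smul (c : R) (f g : Gr R N) : mul f (c • g) = c • mul f g := by
  funext s
  simp only [mul, Pi.smul_apply, smul_eq_mul, Finset.mul_sum]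
  exact Finset.sum_congr rfl fun _ _ => by ring

/-- The multiplication as a bilinear map. -/
def mulₗ : Gr R N →ₗ[R] Gr R N →ₗ[R] Gr R N :=
  LinearMap.mk₂ R mul add_mul smul_mul mul_add mul_smul

lemma neg_mul (f g : Gr R N) : mul (-f) g = -mul f g := (mulₗ (R := R)).map_neg₂ f g

lemma mul_neg (f g : Gr R N) : mul f (-g) = -mul f g := (mulₗ f).map_neg g

lemma sub_mul (f g h : Gr R N) : mul (f - g) h = mul f h - mul g h :=
  (mulₗ (R := R)).map_sub₂ f g h

lemma mul_sub (f g h : Gr R N) : mul f (g - h) = mul f g - mul f h := (mulₗ f).map_sub g h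

lemma mul_zero (f : Gr R N) : mul f 0 = 0 := (mulₗ f).map_zero

lemma zero_mul (f : Gr R N) : mul 0 f = 0 := (mulₗ (R := R)).map_zero₂ f

lemma sum_mul {ι : Type*} (t : Finset ι) (f : ι → Gr R N) (g : Gr R N) :
    mul (∑ i ∈ t, f i) g = ∑ i ∈ t, mul (f i) g := (mulₗ (R := R)).map_sum₂ t f g

lemma one_mul (f : Gr R N) : mul one f = f := by
  funext s
  rw [mul, Finset.sum_eq_single ∅]
  · simp [msign_eq, one]
  · intro A _ hA
    simp [one, hA]
  · simp

lemma mul_one (f : Gr R N) : mul f one = f := by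
  funext s
  rw [mul, Finset.sum_eq_single s]
  · simp [msign_eq, one, sgn]
  · intro A hA hs
    have : s \ A ≠ ∅ := fun h => hs
      (Finset.Subset.antisymm (Finset.mem_powerset.1 hA) (Finset.sdiff_eq_empty_iff_subset.1 h))
    simp [one, this]
  · simp

/-- The left partial derivative as a linear map. -/
def pderivₗ (j : Fin N) : Gr R N →ₗ[R] Gr R N where
  toFun := pderiv j
  map_add' f g := by
    funext s
    simp only [pderiv_apply, Pi.add_apply]
    split_ifs <;> ring
  map_smul' c f := by
    funext s
    simp only [pderiv_apply, Pi.smul_apply, smul_eq_mul, RingHom.id_apply]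
    split_ifs <;> ring

lemma pderiv_add (j : Fin N) (f g : Gr R N) : pderiv j (f + g) = pderiv j f + pderiv j g :=
  (pderivₗ j).map_add f g

lemma pderiv_smul (j : Fin N) (c : R) (f : Gr R N) : pderiv j (c • f) = c • pderiv j f :=
  (pderivₗ j).map_smul c f

lemma pderiv_sub (j : Fin N) (f g : Gr R N) : pderiv j (f - g) = pderiv j f - pderiv j g :=
  (pderivₗ j).map_sub f g

lemma pderiv_zero (j : Fin N) : pderiv j (0 : Gr R N) = 0 := (pderivₗ j).map_zero

lemma pderiv_sum {ι : Type*} (j : Fin N) (t : Finset ι) (f : ι → Gr R N) :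
    pderiv j (∑ i ∈ t, f i) = ∑ i ∈ t, pderiv j (f i) := map_sum (pderivₗ j) f t

lemma parity_add (f g : Gr R N) : parity (f + g) = parity f + parity g := by
  funext s; simp [parity, _root_.mul_add]

lemma parity_smul (c : R) (f : Gr R N) : parity (c • f) = c • parity f := by
  funext s; simp only [parity, Pi.smul_apply, smul_eq_mul]; ring

lemma parity_sub (f g : Gr R N) : parity (f - g) = parity f - parity g := by
  funext s; simp [parity, _root_.mul_sub]

lemma parity_sum {ι : Type*} (t : Finset ι) (f : ι → Gr R N) :
    parity (∑ i ∈ t, f i) = ∑ i ∈ t, parity (f i) := by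
  funext s; simp [parity, Finset.sum_apply, Finset.mul_sum]

lemma parity_one : parity (one : Gr R N) = one := by
  funext s
  by_cases h : s = ∅ <;> simp [parity, one, h]

lemma parity_gen (j : Fin N) : parity (gen j : Gr R N) = -gen j := by
  funext s
  by_cases h : s = {j} <;> simp [parity, gen, h]

lemma parity_gen_mul (j : Fin N) (f : Gr R N) :
    parity (mul (gen j) f) = -mul (gen j) (parity f) := by
  funext s
  simp only [parity, gen_mul_apply, Pi.neg_apply]
  by_cases h : j ∈ s
  · rw [if_pos h, if_pos h, ← Finset.card_erase_add_one h, pow_succ]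
    ring
  · simp [h]

lemma sum_smul_basis (f : Gr R N) : f = ∑ A, f A • basis A := by
  funext s
  simp [basis, Finset.sum_apply, Pi.single_apply]

lemma basis_empty : (basis ∅ : Gr R N) = one := by
  funext s
  simp [basis, one, Pi.single_apply]

lemma pderiv_basis_insert {j : Fin N} {A : Finset (Fin N)} (h : j ∉ A) :
    pderiv j (basis (insert j A) : Gr R N) = (sgn j A : R) • basis A := by
  funext s
  by_cases hs : j ∈ s
  · have : s ≠ A := by rintro rfl; exact h hs
    simp [pderiv_apply, hs, basis, this]
  · have : insert j s = insert j A ↔ s = A :=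
      ⟨fun e => by rw [← Finset.erase_insert hs, e, Finset.erase_insert h], fun e => by rw [e]⟩
    simp only [pderiv_apply, hs, basis, Pi.single_apply, this, Pi.smul_apply]
    by_cases e : s = A <;> simp [e]

lemma pderiv_basis_of_notMem {j : Fin N} {A : Finset (Fin N)} (h : j ∉ A) :
    pderiv j (basis A : Gr R N) = 0 := by
  funext s
  have : insert j s ≠ A := by rintro rfl; simp at h
  simp [pderiv_apply, basis, this]

lemma gen_mul_basis {j : Fin N} {A : Finset (Fin N)} (h : j ∉ A) :
    mul (gen j) (basis A : Gr R N) = (sgn j A : R) • basis (insert j A) := by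
  funext s
  by_cases hs : j ∈ s
  · obtain ⟨t, ht, rfl⟩ : ∃ t, j ∉ t ∧ insert j t = s :=
      ⟨s.erase j, by simp, Finset.insert_erase hs⟩
    have : insert j t = insert j A ↔ t = A :=
      ⟨fun e => by rw [← Finset.erase_insert ht, e, Finset.erase_insert h], fun e => by rw [e]⟩
    simp only [gen_mul_apply, hs, basis, Pi.single_apply, this, Pi.smul_apply,
      Finset.erase_insert ht, sgn_insert_self ht]
    by_cases e : t = A <;> simp [e]
  · have : s ≠ insert j A := by rintro rfl; simp at hs
    simp [gen_mul_apply, hs, basis, this]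

lemma gen_mul_basis_of_mem {j : Fin N} {A : Finset (Fin N)} (h : j ∈ A) :
    mul (gen j) (basis A : Gr R N) = 0 := by
  funext s
  have : s.erase j ≠ A := by rintro rfl; simp at h
  simp [gen_mul_apply, basis, this]

lemma induction_basis {P : Gr R N → Prop} (hadd : ∀ f g, P f → P g → P (f + g))
    (hsmul : ∀ (c : R) f, P f → P (c • f)) (hb : ∀ A, P (basis A)) (f : Gr R N) : P f := by
  rw [sum_smul_basis f]
  exact Finset.sum_induction_nonempty _ P hadd Finset.univ_nonempty fun A _ => hsmul _ _ (hb A)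

/-- The Grassmann algebra is spanned by the iterated products of generators. -/
lemma induction_gen {P : Gr R N → Prop} (hadd : ∀ f g, P f → P g → P (f + g))
    (hsmul : ∀ (c : R) f, P f → P (c • f)) (hone : P one)
    (hgen : ∀ j f, P f → P (mul (gen j) f)) (f : Gr R N) : P f := by
  refine induction_basis hadd hsmul (fun A => ?_) f
  induction A using Finset.induction_on with
  | empty => rwa [basis_empty]
  | insert j A hj ih =>
    have := hsmul (sgn j A) _ (hgen j _ ih)
    rwa [gen_mul_basis hj, smul_smul, sgn_mul_self, one_smul] at this

/-- The Grassmann algebra is spanned by the iterated derivatives of the top monomial. -/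
lemma induction_pderiv {P : Gr R N → Prop} (hadd : ∀ f g, P f → P g → P (f + g))
    (hsmul : ∀ (c : R) f, P f → P (c • f)) (htop : P (basis Finset.univ))
    (hder : ∀ j f, P f → P (pderiv j f)) (f : Gr R N) : P f := by
  refine induction_basis hadd hsmul (fun A => ?_) f
  rw [← compl_compl A]
  induction Aᶜ using Finset.induction_on with
  | empty => simpa using htop
  | insert j B hj ih =>
    have h1 : j ∉ (insert j B)ᶜ := by simp
    have h2 : insert j (insert j B)ᶜ = Bᶜ := by
      ext i
      simp only [Finset.mem_insert, Finset.mem_compl]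
      by_cases h : i = j <;> simp [h, hj]
    have := hsmul (sgn j (insert j B)ᶜ) _ (hder j _ ih)
    rwa [← h2, pderiv_basis_insert h1, smul_smul, sgn_mul_self, one_smul] at this

lemma gen_mul_assoc (j : Fin N) (f g : Gr R N) :
    mul (mul (gen j) f) g = mul (gen j) (mul f g) := by
  funext s
  rw [gen_mul_apply]
  by_cases h : j ∈ s
  · obtain ⟨t, ht, rfl⟩ : ∃ t, j ∉ t ∧ insert j t = s :=
      ⟨s.erase j, by simp, Finset.insert_erase h⟩
    rw [if_pos h, Finset.erase_insert ht, sgn_insert_self ht, mul,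
      Finset.sum_powerset_insert ht, Finset.sum_eq_zero, _root_.zero_add, mul, Finset.mul_sum]
    · refine Finset.sum_congr rfl fun A hA => ?_
      have hA' := Finset.mem_powerset.1 hA
      have hj : j ∉ A := fun h => ht (hA' h)
      have hs : (sgn j t : R) = sgn j A * sgn j (t \ A) := by
        simp only [sgn]
        rw [_root_.mul_comm, Finset.prod_sdiff hA']
      rw [Finset.insert_sdiff_insert, Finset.sdiff_insert_of_notMem ht,
        msign_insert hj, gen_mul_apply, if_pos (Finset.mem_insert_self _ _),
        Finset.erase_insert hj, sgn_insert_self hj, hs]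
      ring
    · intro A hA
      have hj : j ∉ A := fun h => ht (Finset.mem_powerset.1 hA h)
      simp [gen_mul_apply, hj]
  · rw [if_neg h]
    refine Finset.sum_eq_zero fun A hA => ?_
    have hj : j ∉ A := fun h' => h (Finset.mem_powerset.1 hA h')
    simp [gen_mul_apply, hj]

lemma mul_assoc (f g h : Gr R N) : mul (mul f g) h = mul f (mul g h) := by
  refine induction_gen (P := fun f => mul (mul f g) h = mul f (mul g h)) ?_ ?_ ?_ ?_ f
  · intro a b ha hb
    simp only [add_mul, ha, hb]
  · intro c a ha
    simp only [smul_mul, ha]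
  · simp only [one_mul]
  · intro j a ha
    simp only [gen_mul_assoc, ha]

lemma gen_mul_gen_mul (i j : Fin N) (f : Gr R N) :
    mul (gen i) (mul (gen j) f) = -mul (gen j) (mul (gen i) f) := by
  funext s
  simp only [gen_mul_apply, Pi.neg_apply, Finset.mem_erase]
  by_cases hij : i = j
  · subst hij; simp
  by_cases hi : i ∈ s
  · by_cases hj : j ∈ s
    · obtain ⟨t, ht, rfl⟩ : ∃ t, j ∉ t ∧ insert j t = s :=
        ⟨s.erase j, by simp, Finset.insert_erase hj⟩
      obtain ⟨r, hr, rfl⟩ : ∃ r, i ∉ r ∧ insert i r = t :=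
        ⟨t.erase i, by simp, Finset.insert_erase (by simpa [hij] using hi)⟩
      have hjr : j ∉ r := fun h => ht (by simp [h])
      have hji : j ≠ i := fun h => hij h.symm
      rw [Finset.erase_insert ht, Finset.insert_comm j i r,
        Finset.erase_insert (by simp [hij, hr]), Finset.erase_insert hjr,
        Finset.erase_insert hr, Finset.insert_comm i j r, sgn_insert ht, sgn_insert hr,
        sgn_insert ht, sgn_insert hr, sgn_insert hjr]
      rcases lt_or_gt_of_ne hij with h | h <;> simp [h, h.not_gt, hij, hji] <;> ring
    · simp [hj]
  · simp [hi]

lemma pderiv_gen_mul (i j : Fin N) (f : Gr R N) :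
    pderiv i (mul (gen j) f) = (if i = j then f else 0) - mul (gen j) (pderiv i f) := by
  funext s
  rw [Pi.sub_apply]
  simp only [pderiv_apply, gen_mul_apply]
  by_cases hij : i = j
  · subst hij
    by_cases hi : i ∈ s
    · have h : i ∉ s.erase i := by simp
      have hs := sgn_insert_self (R := R) h
      rw [Finset.insert_erase hi] at hs
      simp only [hi, h, if_true, if_false, Finset.insert_erase hi, hs, ← _root_.mul_assoc,
        sgn_mul_self]
      ring
    · simp only [hi, Finset.mem_insert_self, Finset.erase_insert hi, if_true, if_false,
        sgn_insert_self hi, ← _root_.mul_assoc, sgn_mul_self]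
      ring
  · have hji : j ≠ i := fun h => hij h.symm
    by_cases hi : i ∈ s
    · simp [hi, hij]
    · by_cases hj : j ∈ s
      · obtain ⟨r, hr, rfl⟩ : ∃ r, j ∉ r ∧ insert j r = s :=
          ⟨s.erase j, by simp, Finset.insert_erase hj⟩
        have hir : i ∉ r := fun h => hi (by simp [h])
        rw [if_neg hi, if_pos (by simp), if_neg hij, if_pos hj, Finset.erase_insert hr,
          if_neg hir, Finset.insert_comm i j r, Finset.erase_insert (by simp [hji, hr]),
          sgn_insert hr, sgn_insert (by simp [hji, hr]), sgn_insert hir, sgn_insert hr]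
        rcases lt_or_gt_of_ne hij with h | h <;> simp [h, h.not_gt] <;> ring
      · simp [hi, hj, hij, hji]

lemma pderiv_one (i : Fin N) : pderiv i (one : Gr R N) = 0 := by
  rw [← basis_empty, pderiv_basis_of_notMem (by simp)]

lemma pderiv_gen (i j : Fin N) : pderiv i (gen j : Gr R N) = if i = j then one else 0 := by
  rw [← mul_one (gen j), pderiv_gen_mul, pderiv_one, mul_zero, sub_zero]

/-- The graded Leibniz rule. -/
lemma pderiv_mul (i : Fin N) (f g : Gr R N) :
    pderiv i (mul f g) = mul (pderiv i f) g + mul (parity f) (pderiv i g) := by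
  refine induction_gen (P := fun f =>
    pderiv i (mul f g) = mul (pderiv i f) g + mul (parity f) (pderiv i g)) ?_ ?_ ?_ ?_ f
  · intro a b ha hb
    simp only [add_mul, pderiv_add, parity_add, ha, hb]
    abel
  · intro c a ha
    simp only [smul_mul, pderiv_smul, parity_smul, ha, smul_add]
  · simp only [one_mul, pderiv_one, parity_one, zero_mul, _root_.zero_add]
  · intro j a ha
    rw [gen_mul_assoc, pderiv_gen_mul, ha, pderiv_gen_mul, parity_gen_mul, sub_mul, neg_mul,
      gen_mul_assoc, gen_mul_assoc, mul_add]
    split_ifs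
    · abel
    · rw [zero_mul]
      abel

lemma parity_mul (f g : Gr R N) : parity (mul f g) = mul (parity f) (parity g) := by
  refine induction_gen (P := fun f =>
    parity (mul f g) = mul (parity f) (parity g)) ?_ ?_ ?_ ?_ f
  · intro a b ha hb
    simp only [add_mul, parity_add, ha, hb]
  · intro c a ha
    simp only [smul_mul, parity_smul, ha]
  · simp only [one_mul, parity_one]
  · intro j a ha
    simp only [gen_mul_assoc, parity_gen_mul, ha, neg_mul]

lemma mul_gen (f : Gr R N) (j : Fin N) : mul f (gen j) = mul (gen j) (parity f) := by
  refine induction_gen (P := fun f => mul f (gen j) = mul (gen j) (parity f)) ?_ ?_ ?_ ?_ f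
  · intro a b ha hb
    simp only [add_mul, mul_add, parity_add, ha, hb]
  · intro c a ha
    simp only [smul_mul, mul_smul, parity_smul, ha]
  · simp only [one_mul, mul_one, parity_one]
  · intro i a ha
    rw [gen_mul_assoc, ha, parity_gen_mul, mul_neg, gen_mul_gen_mul]

lemma pderiv_pderiv (i j : Fin N) (f : Gr R N) :
    pderiv i (pderiv j f) = -pderiv j (pderiv i f) := by
  refine induction_gen (P := fun f =>
    pderiv i (pderiv j f) = -pderiv j (pderiv i f)) ?_ ?_ ?_ ?_ f
  · intro a b ha hb
    simp only [pderiv_add, ha, hb]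
    abel
  · intro c a ha
    simp only [pderiv_smul, ha, smul_neg]
  · simp only [pderiv_one, pderiv_zero, neg_zero]
  · intro k a ha
    simp only [pderiv_gen_mul, pderiv_sub, ha, mul_neg]
    split_ifs <;> (try simp only [pderiv_zero]) <;> abel

lemma pderiv_self (i : Fin N) (f : Gr R N) : pderiv i (pderiv i f) = 0 := by
  funext s
  simp [pderiv_apply]

lemma derivList_cons (i : Fin N) (l : List (Fin N)) (f : Gr R N) :
    derivList (i :: l) f = derivList l (pderiv i f) := rfl

/-- Iterated derivatives as a linear map. -/
def derivListₗ (l : List (Fin N)) : Gr R N →ₗ[R] Gr R N where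
  toFun := derivList l
  map_add' f g := by
    induction l generalizing f g with
    | nil => rfl
    | cons i l ih => rw [derivList_cons, pderiv_add, ih]; rfl
  map_smul' c f := by
    induction l generalizing f with
    | nil => rfl
    | cons i l ih => rw [derivList_cons, pderiv_smul, ih]; rfl

lemma derivList_neg (l : List (Fin N)) (f : Gr R N) : derivList l (-f) = -derivList l f :=
  (derivListₗ l).map_neg f

lemma derivList_smul (l : List (Fin N)) (c : R) (f : Gr R N) :
    derivList l (c • f) = c • derivList l f :=
  (derivListₗ l).map_smul c f

lemma derivList_zero (l : List (Fin N)) : derivList l (0 : Gr R N) = 0 :=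
  (derivListₗ l).map_zero

lemma derivList_pderiv (l : List (Fin N)) (i : Fin N) (f : Gr R N) :
    derivList l (pderiv i f) = (-1 : R) ^ l.length • pderiv i (derivList l f) := by
  induction l generalizing f with
  | nil => simp [derivList]
  | cons j l ih =>
    rw [derivList_cons, pderiv_pderiv, derivList_neg, ih, derivList_cons, List.length_cons,
      pow_succ, mul_neg_one, neg_smul]

lemma derivList_pderiv_of_mem {l : List (Fin N)} {i : Fin N} (h : i ∈ l) (f : Gr R N) :
    derivList l (pderiv i f) = 0 := by
  induction l generalizing f with
  | nil => simp at h
  | cons j l ih =>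
    rw [derivList_cons]
    rcases List.mem_cons.1 h with rfl | h
    · rw [pderiv_self, derivList_zero]
    · rw [pderiv_pderiv, derivList_neg, ih h, neg_zero]

lemma derivList_gen_mul {l : List (Fin N)} {i : Fin N} (h : i ∉ l) (f : Gr R N) :
    derivList l (mul (gen i) f) = (-1 : R) ^ l.length • mul (gen i) (derivList l f) := by
  induction l generalizing f with
  | nil => simp [derivList]
  | cons j l ih =>
    rw [List.mem_cons, not_or] at h
    rw [derivList_cons, pderiv_gen_mul, if_neg (Ne.symm h.1), zero_sub, derivList_neg, ih h.2,
      derivList_cons, List.length_cons, pow_succ, mul_neg_one, neg_smul]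

lemma derivList_basis {l : List (Fin N)} (h : l.Pairwise (· < ·)) :
    derivList l (basis l.toFinset : Gr R N) = one := by
  induction l with
  | nil => simp [derivList, basis_empty]
  | cons j l ih =>
    rw [List.pairwise_cons] at h
    have hj : j ∉ l.toFinset := fun hj => lt_irrefl j (h.1 j (by simpa using hj))
    have hs : (sgn j l.toFinset : R) = 1 :=
      Finset.prod_eq_one fun i hi => if_neg (h.1 i (by simpa using hi)).not_gt
    rw [derivList_cons, List.toFinset_cons, pderiv_basis_insert hj, hs, one_smul, ih h.2]

end Algebra
end Gr

namespace Gr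

section Substitution

variable {N M : ℕ}

lemma monom_empty (η : Fin N → Gr ℂ M) : monom η ∅ = one := by
  simp [monom]

lemma monom_insert (η : Fin N → Gr ℂ M) {a : Fin N} {A : Finset (Fin N)} (h : ∀ b ∈ A, a < b) :
    monom η (insert a A) = mul (η a) (monom η A) := by
  rw [monom, Finset.sort_insert _ (fun b hb => (h b hb).le) (fun ha => lt_irrefl a (h a ha))]
  rfl

lemma subst_add (η : Fin N → Gr ℂ M) (f g : Gr ℂ N) :
    subst η (f + g) = subst η f + subst η g := by
  simp [subst, add_smul, Finset.sum_add_distrib]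

lemma subst_smul (η : Fin N → Gr ℂ M) (c : ℂ) (f : Gr ℂ N) :
    subst η (c • f) = c • subst η f := by
  simp only [subst, Finset.smul_sum, Pi.smul_apply, smul_assoc]

lemma subst_neg (η : Fin N → Gr ℂ M) (f : Gr ℂ N) : subst η (-f) = -subst η f := by
  rw [← neg_one_smul ℂ f, subst_smul, neg_one_smul]

lemma subst_sub (η : Fin N → Gr ℂ M) (f g : Gr ℂ N) :
    subst η (f - g) = subst η f - subst η g := by
  rw [sub_eq_add_neg, subst_add, subst_neg, sub_eq_add_neg]

lemma subst_zero (η : Fin N → Gr ℂ M) : subst η 0 = 0 := by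
  simp [subst]

lemma subst_basis (η : Fin N → Gr ℂ M) (A : Finset (Fin N)) :
    subst η (basis A) = monom η A := by
  rw [subst, Finset.sum_eq_single A]
  · simp [basis]
  · intro B _ hB
    simp [basis, hB]
  · simp

lemma gen_mul_basis_of_lt {a : Fin N} {A : Finset (Fin N)} (h : ∀ b ∈ A, a < b) :
    mul (gen a) (basis A : Gr ℂ N) = basis (insert a A) := by
  have hs : (sgn a A : ℂ) = 1 := Finset.prod_eq_one fun i hi => if_neg (h i hi).not_gt
  rw [gen_mul_basis fun ha => lt_irrefl a (h a ha), hs, one_smul]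

lemma subst_one (η : Fin N → Gr ℂ M) : subst η one = one := by
  rw [← basis_empty, subst_basis, monom_empty]

/-- The chain rule for odd substitutions with constant partial derivatives. -/
lemma pderiv_subst {η : Fin N → Gr ℂ M} {i : Fin M} {t : Fin N} {c : ℂ}
    (hη : ∀ j, pderiv i (η j) = if t = j then c • one else 0)
    (hp : ∀ j, parity (η j) = -η j) (f : Gr ℂ N) :
    pderiv i (subst η f) = c • subst η (pderiv t f) := by
  refine induction_basis (P := fun f =>
    pderiv i (subst η f) = c • subst η (pderiv t f)) ?_ ?_ ?_ f
  · intro a b ha hb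
    simp only [subst_add, pderiv_add, ha, hb, smul_add]
  · intro d a ha
    simp only [subst_smul, pderiv_smul, ha, smul_comm c d]
  intro A
  induction A using Finset.induction_on_min with
  | empty => simp only [basis_empty, subst_one, pderiv_one, subst_zero, smul_zero]
  | insert a A ha ih =>
    have key : subst η (mul (gen a) (pderiv t (basis A))) =
        mul (η a) (subst η (pderiv t (basis A))) := by
      by_cases ht : t ∈ A
      · obtain ⟨B, hB, rfl⟩ : ∃ B, t ∉ B ∧ insert t B = A :=
          ⟨A.erase t, by simp, Finset.insert_erase ht⟩
        have haB : ∀ b ∈ B, a < b := fun b hb => ha b (Finset.mem_insert_of_mem hb)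
        rw [pderiv_basis_insert hB, mul_smul, gen_mul_basis_of_lt haB, subst_smul, subst_smul,
          subst_basis, subst_basis, monom_insert η haB, mul_smul]
      · rw [pderiv_basis_of_notMem ht, mul_zero, subst_zero, mul_zero]
    rw [subst_basis, monom_insert η ha, pderiv_mul, hη, hp, neg_mul, ← subst_basis, ih,
      ← gen_mul_basis_of_lt ha, pderiv_gen_mul, subst_sub, key, smul_sub, mul_smul]
    split_ifs
    · rw [smul_mul, one_mul, sub_eq_add_neg]
    · rw [zero_mul, subst_zero, smul_zero, sub_eq_add_neg]

lemma parity_monom {η : Fin N → Gr ℂ M} (hp : ∀ j, parity (η j) = -η j) (A : Finset (Fin N)) :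
    parity (monom η A) = (-1 : ℂ) ^ A.card • monom η A := by
  induction A using Finset.induction_on_min with
  | empty => simp [monom_empty, parity_one]
  | insert a A ha ih =>
    rw [monom_insert η ha, parity_mul, ih, hp,
      Finset.card_insert_of_notMem fun h => lt_irrefl a (ha a h), neg_mul, mul_smul, pow_succ,
      mul_neg_one, neg_smul]

lemma mul_monom_of_mem {η : Fin N → Gr ℂ M}
    (hanti : ∀ i j f, mul (η i) (mul (η j) f) = -mul (η j) (mul (η i) f))
    {j : Fin N} {A : Finset (Fin N)} (hj : j ∈ A) : mul (η j) (monom η A) = 0 := by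
  induction A using Finset.induction_on_min with
  | empty => simp at hj
  | insert a A ha ih =>
    rw [monom_insert η ha]
    rcases Finset.mem_insert.1 hj with rfl | h
    · exact self_eq_neg.1 (hanti j j _)
    · rw [hanti, ih h, mul_zero, neg_zero]

end Substitution

section Restriction

variable {N M : ℕ} {φ : Fin N → Fin M}

/-- The coefficients of an element along the monomials in the generators `φ j`. -/
def pull (φ : Fin N → Fin M) (F : Gr ℂ M) : Gr ℂ N := fun s => F (s.image φ)

lemma sgn_image (hφ : StrictMono φ) (j : Fin N) (s : Finset (Fin N)) :
    (sgn (φ j) (s.image φ) : ℂ) = sgn j s := by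
  simp only [sgn]
  rw [Finset.prod_image hφ.injective.injOn]
  simp [hφ.lt_iff_lt]

lemma pull_pderiv (hφ : StrictMono φ) (j : Fin N) (F : Gr ℂ M) :
    pull φ (pderiv (φ j) F) = pderiv j (pull φ F) := by
  funext s
  simp only [pull, pderiv_apply, hφ.injective.mem_finset_image, sgn_image hφ, Finset.image_insert]

lemma pull_gen_mul (hφ : StrictMono φ) (j : Fin N) (F : Gr ℂ M) :
    pull φ (mul (gen (φ j)) F) = mul (gen j) (pull φ F) := by
  funext s
  simp only [pull, gen_mul_apply, hφ.injective.mem_finset_image, sgn_image hφ,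
    Finset.image_erase hφ.injective]

lemma pull_one : pull φ one = one := by
  funext s
  simp [pull, one]

lemma pull_smul (c : ℂ) (F : Gr ℂ M) : pull φ (c • F) = c • pull φ F := rfl

end Restriction

section Exponential

variable {N : ℕ}

lemma mul_apply_eq_zero_of_card {f g : Gr ℂ N} {k l : ℕ} (hf : ∀ s, s.card < k → f s = 0)
    (hg : ∀ s, s.card < l → g s = 0) (s : Finset (Fin N)) (hs : s.card < k + l) :
    mul f g s = 0 := by
  refine Finset.sum_eq_zero fun A hA => ?_
  have := Finset.card_sdiff_add_card_eq_card (Finset.mem_powerset.1 hA)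
  rcases lt_or_ge A.card k with h | h
  · simp [hf A h]
  · simp [hg (s \ A) (by omega)]

lemma pow_apply_eq_zero_of_card {w : Gr ℂ N} (hw : w ∅ = 0) (k : ℕ) (s : Finset (Fin N))
    (hs : s.card < k) : pow w k s = 0 := by
  induction k generalizing s with
  | zero => simp at hs
  | succ k ih =>
    refine mul_apply_eq_zero_of_card ih (l := 1) (fun t ht => ?_) s hs
    rwa [Finset.card_eq_zero.1 (Nat.lt_one_iff.1 ht)]

lemma parity_pow {w : Gr ℂ N} (hp : parity w = w) (k : ℕ) : parity (pow w k) = pow w k := by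
  induction k with
  | zero => exact parity_one
  | succ k ih => rw [pow, parity_mul, ih, hp]

lemma parity_gexp {w : Gr ℂ N} (hp : parity w = w) : parity (gexp w) = gexp w := by
  simp only [gexp, parity_sum, parity_smul, parity_pow hp]

lemma pderiv_pow {w : Gr ℂ N} (hp : parity w = w) {i y : Fin N} {c : ℂ}
    (hd : pderiv i w = c • gen y) (k : ℕ) :
    pderiv i (pow w (k + 1)) = ((k + 1 : ℕ) : ℂ) • c • mul (gen y) (pow w k) := by
  induction k with
  | zero => simp [pow, one_mul, hd, mul_one]
  | succ k ih =>
    rw [pow, pderiv_mul, ih, parity_pow hp, hd, mul_smul, mul_gen, parity_pow hp, smul_mul,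
      smul_mul, gen_mul_assoc, ← pow, Nat.cast_succ (k + 1), add_smul, one_smul]

lemma pderiv_gexp {w : Gr ℂ N} (hp : parity w = w) (hw : w ∅ = 0) {i y : Fin N} {c : ℂ}
    (hd : pderiv i w = c • gen y) :
    pderiv i (gexp w) = c • mul (gen y) (gexp w) := by
  have htop : mul (gen y) (pow w N) = 0 := by
    funext s
    rw [gen_mul_apply]
    split_ifs with h
    · have h1 := Finset.card_erase_lt_of_mem h
      have h2 : s.card ≤ N := by simpa using Finset.card_le_univ s
      rw [pow_apply_eq_zero_of_card hw N _ (by omega), MulZeroClass.mul_zero, Pi.zero_apply]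
    · rfl
  have hR : mul (gen y) (gexp w) =
      ∑ k ∈ Finset.range N, ((k.factorial : ℂ))⁻¹ • mul (gen y) (pow w k) := by
    rw [gexp, Finset.sum_range_succ, mul_add, mul_smul, htop, smul_zero, _root_.add_zero]
    simp only [← mul_smul]
    exact map_sum (mulₗ (gen y)) _ _
  rw [hR, gexp, Finset.sum_range_succ', pderiv_add, pderiv_smul, pow, pderiv_one, smul_zero,
    _root_.add_zero, pderiv_sum, Finset.smul_sum]
  refine Finset.sum_congr rfl fun k _ => ?_
  rw [pderiv_smul, pderiv_pow hp hd, smul_smul, smul_smul, smul_smul]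
  congr 1
  rw [Nat.factorial_succ]
  have := k.factorial_ne_zero
  have := k.succ_ne_zero
  push_cast
  field_simp

lemma gexp_mul_eq_self {w E : Gr ℂ N} (h : mul w E = 0) : mul (gexp w) E = E := by
  rw [gexp, sum_mul, Finset.sum_range_succ', Finset.sum_eq_zero, _root_.zero_add]
  · simp [pow, one_mul]
  · intro k _
    rw [smul_mul, pow, mul_assoc, h, mul_zero, smul_zero]

end Exponential

end Gr

section Fermionic

open Gr

variable {n : ℕ}

lemma xi_strictMono : StrictMono (xi n) := Fin.strictMono_castAdd _

lemma yi_strictMono : StrictMono (yi n) := Fin.strictMono_natAdd _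

lemma xi_ne_yi (s t : Fin (2 * n)) : xi n s ≠ yi n t := by
  have := s.isLt
  simp only [xi, yi, ne_eq, Fin.ext_iff, Fin.val_castAdd, Fin.val_natAdd]
  omega

lemma embX_image (f : Gr ℂ (2 * n)) (A : Finset (Fin (2 * n))) :
    embX n f (A.image (xi n)) = f A := by
  have h : ∀ B : Finset (Fin (2 * n)), A.image (xi n) = B.image (xi n) ↔ A = B := fun B =>
    (Finset.image_injective xi_strictMono.injective).eq_iff
  simp [embX, h]

lemma embX_eq_zero (f : Gr ℂ (2 * n)) {s : Finset (Fin (2 * n + 2 * n))}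
    (h : ∀ A : Finset (Fin (2 * n)), A.image (xi n) ≠ s) : embX n f s = 0 :=
  Finset.sum_eq_zero fun A _ => if_neg (h A).symm

/-- The embedding in the `x` variables as a linear map. -/
def embXₗ (n : ℕ) : Gr ℂ (2 * n) →ₗ[ℂ] Gr ℂ (2 * n + 2 * n) where
  toFun := embX n
  map_add' f g := by
    funext s
    simp only [embX, Pi.add_apply, ← Finset.sum_add_distrib]
    exact Finset.sum_congr rfl fun A _ => by split_ifs <;> simp
  map_smul' c f := by
    funext s
    simp [embX, Finset.mul_sum]

lemma pull_embX (f : Gr ℂ (2 * n)) : pull (xi n) (embX n f) = f :=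
  funext fun A => embX_image f A

lemma embX_pderiv (t : Fin (2 * n)) (f : Gr ℂ (2 * n)) :
    embX n (pderiv t f) = pderiv (xi n t) (embX n f) := by
  funext s
  by_cases hs : ∃ A : Finset (Fin (2 * n)), A.image (xi n) = s
  · obtain ⟨A, rfl⟩ := hs
    have := congrFun (pull_pderiv xi_strictMono t (embX n f)) A
    rw [pull_embX] at this
    rw [embX_image, ← this]
    rfl
  · push Not at hs
    rw [embX_eq_zero _ hs, pderiv_apply]
    split_ifs with h
    · rfl
    · rw [embX_eq_zero, MulZeroClass.mul_zero]
      intro A hA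
      refine hs (A.erase t) ?_
      rw [Finset.image_erase xi_strictMono.injective, hA, Finset.erase_insert h]

lemma embX_gen_mul (t : Fin (2 * n)) (f : Gr ℂ (2 * n)) :
    embX n (Gr.mul (gen t) f) = Gr.mul (gen (xi n t)) (embX n f) := by
  funext s
  by_cases hs : ∃ A : Finset (Fin (2 * n)), A.image (xi n) = s
  · obtain ⟨A, rfl⟩ := hs
    have := congrFun (pull_gen_mul xi_strictMono t (embX n f)) A
    rw [pull_embX] at this
    rw [embX_image, ← this]
    rfl
  · push Not at hs
    rw [embX_eq_zero _ hs, gen_mul_apply]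
    split_ifs with h
    · rw [embX_eq_zero, MulZeroClass.mul_zero]
      intro A hA
      refine hs (insert t A) ?_
      rw [Finset.image_insert, hA, Finset.insert_erase h]
    · rfl

lemma embX_one : embX n one = one := by
  funext s
  by_cases hs : ∃ A : Finset (Fin (2 * n)), A.image (xi n) = s
  · obtain ⟨A, rfl⟩ := hs
    rw [embX_image]
    simp [one]
  · push Not at hs
    rw [embX_eq_zero _ hs, one, if_neg]
    rintro rfl
    exact hs ∅ rfl

lemma pderiv_yi_embX (t : Fin (2 * n)) (f : Gr ℂ (2 * n)) :
    pderiv (yi n t) (embX n f) = 0 := by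
  funext s
  rw [pderiv_apply, embX_eq_zero, MulZeroClass.mul_zero, ite_self]
  · rfl
  · intro A hA
    have := Finset.mem_insert_self (yi n t) s
    rw [← hA, Finset.mem_image] at this
    obtain ⟨a, -, ha⟩ := this
    exact xi_ne_yi _ _ ha

/-- The Berezin integral in the `x` variables as a linear map. -/
def berezinXₗ (n : ℕ) : Gr ℂ (2 * n + 2 * n) →ₗ[ℂ] Gr ℂ (2 * n + 2 * n) :=
  ((Real.pi : ℂ) ^ n)⁻¹ • derivListₗ ((List.finRange (2 * n)).map (xi n))

lemma berezinX_pderiv_xi (t : Fin (2 * n)) (F : Gr ℂ (2 * n + 2 * n)) :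
    berezinX n (pderiv (xi n t) F) = 0 := by
  rw [berezinX, derivList_pderiv_of_mem (List.mem_map_of_mem (List.mem_finRange t)), smul_zero]

lemma berezinX_pderiv_yi (t : Fin (2 * n)) (F : Gr ℂ (2 * n + 2 * n)) :
    berezinX n (pderiv (yi n t) F) = pderiv (yi n t) (berezinX n F) := by
  rw [berezinX, derivList_pderiv, berezinX, pderiv_smul]
  simp

lemma berezinX_gen_yi_mul (t : Fin (2 * n)) (F : Gr ℂ (2 * n + 2 * n)) :
    berezinX n (Gr.mul (gen (yi n t)) F) = Gr.mul (gen (yi n t)) (berezinX n F) := by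
  rw [berezinX, derivList_gen_mul, berezinX, Gr.mul_smul]
  · simp
  · simp [xi_ne_yi]

lemma derivList_map_xi_embX (l : List (Fin (2 * n))) (f : Gr ℂ (2 * n)) :
    derivList (l.map (xi n)) (embX n f) = embX n (derivList l f) := by
  induction l generalizing f with
  | nil => rfl
  | cons i l ih => rw [List.map_cons, derivList_cons, ← embX_pderiv, ih, derivList_cons]

lemma derivList_finRange_basis_univ :
    derivList (List.finRange (2 * n)) (basis Finset.univ : Gr ℂ (2 * n)) = one := by
  rw [← List.toFinset_finRange, derivList_basis (List.sortedLT_finRange _).pairwise]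

/-- The purely fermionic part of the Fourier transform, without its normalising constant. -/
def fermFTₗ (n : ℕ) (σ : ℂ) : Gr ℂ (2 * n) →ₗ[ℂ] Gr ℂ (2 * n) where
  toFun f := pull (yi n) (berezinX n (Gr.mul (fermK n σ) (embX n f)))
  map_add' f g := congrArg (pull (yi n))
    ((berezinXₗ n ∘ₗ mulₗ (fermK n σ) ∘ₗ embXₗ n).map_add f g)
  map_smul' c f := congrArg (pull (yi n))
    ((berezinXₗ n ∘ₗ mulₗ (fermK n σ) ∘ₗ embXₗ n).map_smul c f)

/-- The odd elements `u_j - x_j` substituted in the convolution. -/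
def diffGen (n : ℕ) (j : Fin (2 * n)) : Gr ℂ (2 * n + 2 * n) := gen (yi n j) - gen (xi n j)

/-- The purely fermionic convolution. -/
def fermConv (n : ℕ) : Gr ℂ (2 * n) →ₗ[ℂ] Gr ℂ (2 * n) →ₗ[ℂ] Gr ℂ (2 * n) :=
  LinearMap.mk₂ ℂ
    (fun f g => pull (yi n) (berezinX n (Gr.mul (subst (diffGen n) f) (embX n g))))
    (fun f f' g => by
      rw [subst_add, Gr.add_mul]
      exact congrArg (pull (yi n)) ((berezinXₗ n).map_add _ _))
    (fun c f g => by
      rw [subst_smul, Gr.smul_mul]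
      exact congrArg (pull (yi n)) ((berezinXₗ n).map_smul _ _))
    (fun f g g' => congrArg (pull (yi n))
      ((berezinXₗ n ∘ₗ mulₗ (subst (diffGen n) f) ∘ₗ embXₗ n).map_add g g'))
    (fun c f g => congrArg (pull (yi n))
      ((berezinXₗ n ∘ₗ mulₗ (subst (diffGen n) f) ∘ₗ embXₗ n).map_smul c g))

lemma fermFTₗ_apply (σ : ℂ) (f : Gr ℂ (2 * n)) :
    fermFTₗ n σ f = pull (yi n) (berezinX n (Gr.mul (fermK n σ) (embX n f))) := rfl

lemma fermConv_apply (f g : Gr ℂ (2 * n)) : fermConv n f g =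
    pull (yi n) (berezinX n (Gr.mul (subst (diffGen n) f) (embX n g))) := rfl

lemma parity_diffGen (j : Fin (2 * n)) : parity (diffGen n j) = -diffGen n j := by
  rw [diffGen, parity_sub, parity_gen, parity_gen]
  abel

lemma diffGen_mul_diffGen_mul (i j : Fin (2 * n)) (F : Gr ℂ (2 * n + 2 * n)) :
    Gr.mul (diffGen n i) (Gr.mul (diffGen n j) F) =
      -Gr.mul (diffGen n j) (Gr.mul (diffGen n i) F) := by
  simp only [diffGen, Gr.sub_mul, Gr.mul_sub]
  rw [gen_mul_gen_mul (yi n i) (yi n j), gen_mul_gen_mul (yi n i) (xi n j),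
    gen_mul_gen_mul (xi n i) (yi n j), gen_mul_gen_mul (xi n i) (xi n j)]
  abel

lemma pderiv_yi_diffGen (t j : Fin (2 * n)) :
    pderiv (yi n t) (diffGen n j) = if t = j then (1 : ℂ) • one else 0 := by
  rw [diffGen, pderiv_sub, pderiv_gen, pderiv_gen, if_neg (xi_ne_yi j t).symm, sub_zero, one_smul]
  simp [yi_strictMono.injective.eq_iff]

lemma pderiv_xi_diffGen (t j : Fin (2 * n)) :
    pderiv (xi n t) (diffGen n j) = if t = j then (-1 : ℂ) • one else 0 := by
  rw [diffGen, pderiv_sub, pderiv_gen, pderiv_gen, if_neg (xi_ne_yi t j), zero_sub]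
  simp only [xi_strictMono.injective.eq_iff]
  split_ifs <;> simp

lemma pderiv_yi_subst_diffGen (t : Fin (2 * n)) (f : Gr ℂ (2 * n)) :
    pderiv (yi n t) (subst (diffGen n) f) = subst (diffGen n) (pderiv t f) := by
  rw [pderiv_subst (pderiv_yi_diffGen t) parity_diffGen, one_smul]

lemma derivList_map_xi_subst_diffGen (l : List (Fin (2 * n))) (f : Gr ℂ (2 * n)) :
    derivList (l.map (xi n)) (subst (diffGen n) f) =
      (-1 : ℂ) ^ l.length • subst (diffGen n) (derivList l f) := by
  induction l generalizing f with
  | nil => simp [derivList]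
  | cons i l ih =>
    rw [List.map_cons, derivList_cons, pderiv_subst (pderiv_xi_diffGen i) parity_diffGen,
      derivList_smul, ih, derivList_cons, List.length_cons, smul_smul, pow_succ']

lemma fermConv_pderiv (t : Fin (2 * n)) (f g : Gr ℂ (2 * n)) :
    fermConv n (pderiv t f) g = pderiv t (fermConv n f g) := by
  rw [fermConv_apply, fermConv_apply, ← pull_pderiv yi_strictMono, ← berezinX_pderiv_yi,
    pderiv_mul, pderiv_yi_embX, Gr.mul_zero, add_zero, pderiv_yi_subst_diffGen]

/-- The monomial `(u_1 - x_1) ⋯ (u_{2n} - x_{2n})` acts as the fermionic delta function. -/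
lemma fermConv_basis_univ (g : Gr ℂ (2 * n)) :
    fermConv n (basis Finset.univ) g = ((Real.pi : ℂ) ^ n)⁻¹ • g := by
  refine induction_gen (P := fun g =>
    fermConv n (basis Finset.univ) g = ((Real.pi : ℂ) ^ n)⁻¹ • g) ?_ ?_ ?_ ?_ g
  · intro a b ha hb
    rw [map_add, ha, hb, smul_add]
  · intro c a ha
    rw [map_smul, ha, smul_comm]
  · rw [fermConv_apply, embX_one, Gr.mul_one, berezinX, derivList_map_xi_subst_diffGen,
      derivList_finRange_basis_univ, subst_one, pull_smul, pull_smul, pull_one]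
    simp
  · intro t a ha
    have hp : parity (monom (diffGen n) Finset.univ) = monom (diffGen n) Finset.univ := by
      rw [parity_monom parity_diffGen]
      simp
    have h0 : Gr.mul (monom (diffGen n) Finset.univ) (gen (xi n t)) =
        Gr.mul (monom (diffGen n) Finset.univ) (gen (yi n t)) := by
      have h := mul_monom_of_mem diffGen_mul_diffGen_mul (Finset.mem_univ t)
      rw [diffGen, Gr.sub_mul, sub_eq_zero] at h
      rw [mul_gen, mul_gen, hp, h]
    rw [fermConv_apply, subst_basis, embX_gen_mul, ← Gr.mul_assoc, h0, mul_gen, hp, gen_mul_assoc,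
      berezinX_gen_yi_mul, pull_gen_mul yi_strictMono, ← subst_basis, ← fermConv_apply, ha,
      Gr.mul_smul]

lemma lo_or_hi (t : Fin (2 * n)) : ∃ j, t = lo n j ∨ t = hi n j := by
  have := t.isLt
  refine ⟨⟨t / 2, by omega⟩, ?_⟩
  simp only [lo, hi, Fin.ext_iff]
  omega

/-- The quadratic element in the exponent of the fermionic Fourier kernel. -/
def fermPhase (n : ℕ) (σ : ℂ) : Gr ℂ (2 * n + 2 * n) :=
  (-σ * (Complex.I / 2)) • ∑ j : Fin n,
    (Gr.mul (gen (xi n (lo n j))) (gen (yi n (hi n j))) -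
     Gr.mul (gen (xi n (hi n j))) (gen (yi n (lo n j))))

lemma fermK_eq (σ : ℂ) : fermK n σ = gexp (fermPhase n σ) := rfl

lemma parity_fermPhase (σ : ℂ) : parity (fermPhase n σ) = fermPhase n σ := by
  simp only [fermPhase, parity_smul, parity_sum, parity_sub, parity_gen_mul, parity_gen,
    Gr.mul_neg, neg_neg]

lemma fermPhase_empty (σ : ℂ) : fermPhase n σ ∅ = 0 := by
  simp [fermPhase, Finset.sum_apply, gen_mul_apply]

lemma exists_pderiv_fermPhase (σ : ℂ) (t : Fin (2 * n)) :
    ∃ (c : ℂ) (r : Fin (2 * n)), pderiv (xi n t) (fermPhase n σ) = c • gen (yi n r) := by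
  have hll : ∀ i j, lo n i = lo n j ↔ i = j := fun i j => by
    simp only [lo, Fin.ext_iff]; omega
  have hhh : ∀ i j, hi n i = hi n j ↔ i = j := fun i j => by
    simp only [hi, Fin.ext_iff]; omega
  have hlh : ∀ i j, lo n i ≠ hi n j := fun i j => by
    simp only [lo, hi, ne_eq, Fin.ext_iff]; omega
  obtain ⟨j, rfl | rfl⟩ := lo_or_hi t
  · refine ⟨-σ * (Complex.I / 2), hi n j, ?_⟩
    rw [fermPhase, pderiv_smul, pderiv_sum]
    simp [pderiv_sub, pderiv_gen_mul, pderiv_gen, xi_strictMono.injective.eq_iff, xi_ne_yi,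
      Gr.mul_zero, hll, hlh]
  · refine ⟨σ * (Complex.I / 2), lo n j, ?_⟩
    rw [fermPhase, pderiv_smul, pderiv_sum]
    simp [pderiv_sub, pderiv_gen_mul, pderiv_gen, xi_strictMono.injective.eq_iff, xi_ne_yi,
      Gr.mul_zero, hhh, (hlh _ _).symm]

lemma exists_fermFTₗ_pderiv (σ : ℂ) (t : Fin (2 * n)) :
    ∃ (c : ℂ) (r : Fin (2 * n)), ∀ f : Gr ℂ (2 * n),
      fermFTₗ n σ (pderiv t f) = c • Gr.mul (gen r) (fermFTₗ n σ f) := by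
  obtain ⟨c, r, h⟩ := exists_pderiv_fermPhase σ t
  refine ⟨-c, r, fun f => ?_⟩
  have hK := pderiv_gexp (parity_fermPhase σ) (fermPhase_empty σ) h
  have h0 := berezinX_pderiv_xi t (Gr.mul (fermK n σ) (embX n f))
  rw [pderiv_mul, fermK_eq, hK, parity_gexp (parity_fermPhase σ), Gr.smul_mul, gen_mul_assoc,
    ← embX_pderiv, ← fermK_eq] at h0
  have h1 : berezinX n (Gr.mul (fermK n σ) (embX n (pderiv t f))) =
      -c • Gr.mul (gen (yi n r)) (berezinX n (Gr.mul (fermK n σ) (embX n f))) := by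
    rw [← berezinX_gen_yi_mul, neg_smul, eq_neg_iff_add_eq_zero]
    exact (add_comm _ _).trans <| (((berezinXₗ n).map_add _ _).trans
      (congrArg₂ _ ((berezinXₗ n).map_smul _ _) rfl)).symm.trans h0
  rw [fermFTₗ_apply, h1, pull_smul, pull_gen_mul yi_strictMono, fermFTₗ_apply]

lemma fermFTₗ_basis_univ (σ : ℂ) :
    fermFTₗ n σ (basis Finset.univ) = ((Real.pi : ℂ) ^ n)⁻¹ • one := by
  have hx : ∀ t, Gr.mul (gen (xi n t)) (embX n (basis Finset.univ)) = 0 := fun t => by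
    rw [← embX_gen_mul, gen_mul_basis_of_mem (Finset.mem_univ t)]
    exact (embXₗ n).map_zero
  have hxy : ∀ t r, Gr.mul (Gr.mul (gen (xi n t)) (gen (yi n r)))
      (embX n (basis Finset.univ)) = 0 := fun t r => by
    rw [gen_mul_assoc, gen_mul_gen_mul, hx, Gr.mul_zero, neg_zero]
  have hw : Gr.mul (fermPhase n σ) (embX n (basis Finset.univ)) = 0 := by
    rw [fermPhase, Gr.smul_mul, Gr.sum_mul]
    simp [Gr.sub_mul, hxy]
  rw [fermFTₗ_apply, fermK_eq, gexp_mul_eq_self hw, berezinX, derivList_map_xi_embX,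
    derivList_finRange_basis_univ, embX_one, pull_smul, pull_one]

/-- The convolution theorem for the purely fermionic Fourier transform. -/
lemma fermFTₗ_fermConv (σ : ℂ) (f g : Gr ℂ (2 * n)) :
    fermFTₗ n σ (fermConv n f g) = Gr.mul (fermFTₗ n σ f) (fermFTₗ n σ g) := by
  refine induction_pderiv (P := fun f =>
    fermFTₗ n σ (fermConv n f g) = Gr.mul (fermFTₗ n σ f) (fermFTₗ n σ g)) ?_ ?_ ?_ ?_ f
  · intro a b ha hb
    rw [map_add, LinearMap.add_apply, map_add, map_add, Gr.add_mul, ha, hb]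
  · intro c a ha
    rw [map_smul, LinearMap.smul_apply, map_smul, map_smul, Gr.smul_mul, ha]
  · rw [fermConv_basis_univ, map_smul, fermFTₗ_basis_univ, Gr.smul_mul, Gr.one_mul]
  · intro t a ha
    obtain ⟨c, r, h⟩ := exists_fermFTₗ_pderiv σ t
    rw [fermConv_pderiv, h, h, ha, Gr.smul_mul, gen_mul_assoc]

end Fermionic

section Integration

variable {m n : ℕ}

/-- The exponential factor `exp(σ i Σ_i x_i y_i)` of the Fourier kernel. -/
def bosK (σ : ℂ) (x y : Fin m → ℝ) : ℂ :=
  Complex.exp (σ * Complex.I * ∑ i, (x i : ℂ) * (y i : ℂ))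

lemma bosK_sub_mul (σ : ℂ) (u x y : Fin m → ℝ) :
    bosK σ x y * bosK σ (u - x) y = bosK σ u y := by
  rw [bosK, bosK, bosK, ← Complex.exp_add, ← mul_add, ← Finset.sum_add_distrib]
  congr 2
  refine Finset.sum_congr rfl fun i _ => ?_
  rw [Pi.sub_apply]
  push_cast
  ring

lemma norm_bosK {σ : ℂ} (hσ : σ = 1 ∨ σ = -1) (x y : Fin m → ℝ) : ‖bosK σ x y‖ = 1 := by
  rw [bosK]
  have h : (∑ i, (x i : ℂ) * (y i : ℂ)) = ((∑ i, x i * y i : ℝ) : ℂ) := by push_cast; rfl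
  rw [h]
  rcases hσ with rfl | rfl
  · rw [one_mul, mul_comm, Complex.norm_exp_ofReal_mul_I]
  · rw [show -1 * Complex.I * ((∑ i, x i * y i : ℝ) : ℂ) =
      ((-∑ i, x i * y i : ℝ) : ℂ) * Complex.I by push_cast; ring, Complex.norm_exp_ofReal_mul_I]

lemma continuous_bosK (σ : ℂ) (y : Fin m → ℝ) : Continuous fun x => bosK σ x y := by
  unfold bosK
  fun_prop

lemma integrable_bosK_mul {σ : ℂ} (hσ : σ = 1 ∨ σ = -1) (y : Fin m → ℝ)
    {p : (Fin m → ℝ) → ℂ} (hp : Integrable p) : Integrable fun x => bosK σ x y * p x :=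
  hp.bdd_mul (continuous_bosK σ y).aestronglyMeasurable
    (Filter.Eventually.of_forall fun x => (norm_bosK hσ x y).le)

lemma bosK_mul_integral (σ : ℂ) (y : Fin m → ℝ) (p q : (Fin m → ℝ) → ℂ) (u : Fin m → ℝ) :
    bosK σ u y * ∫ x, p (u - x) * q x =
      MeasureTheory.convolution (fun x => bosK σ x y * q x) (fun x => bosK σ x y * p x)
        (ContinuousLinearMap.mul ℝ ℂ) volume u := by
  rw [MeasureTheory.convolution, ← integral_const_mul]
  refine integral_congr_ae (Filter.Eventually.of_forall fun x => ?_)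
  simp only [ContinuousLinearMap.mul_apply', ← bosK_sub_mul σ u x y]
  ring

lemma integrable_bosK_mul_integral {σ : ℂ} (hσ : σ = 1 ∨ σ = -1) (y : Fin m → ℝ)
    {p q : (Fin m → ℝ) → ℂ} (hp : Integrable p) (hq : Integrable q) :
    Integrable fun u => bosK σ u y * ∫ x, p (u - x) * q x := by
  simp only [bosK_mul_integral]
  exact (integrable_bosK_mul hσ y hq).integrable_convolution _ (integrable_bosK_mul hσ y hp)

lemma integral_bosK_mul_integral {σ : ℂ} (hσ : σ = 1 ∨ σ = -1) (y : Fin m → ℝ)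
    {p q : (Fin m → ℝ) → ℂ} (hp : Integrable p) (hq : Integrable q) :
    ∫ u, bosK σ u y * ∫ x, p (u - x) * q x =
      (∫ x, bosK σ x y * p x) * ∫ x, bosK σ x y * q x := by
  simp only [bosK_mul_integral]
  rw [integral_convolution _ (integrable_bosK_mul hσ y hq) (integrable_bosK_mul hσ y hp),
    ContinuousLinearMap.mul_apply', mul_comm]

/-- The coefficientwise (unnormalised) Fourier transform in the commuting variables. -/
def bosFT (m n : ℕ) (σ : ℂ) (f : SF m n) (y : Fin m → ℝ) : Gr ℂ (2 * n) :=
  fun s => ∫ x, bosK σ x y * f x s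

lemma linearMap_apply_eq_sum {N : ℕ} (L : Gr ℂ N →ₗ[ℂ] Gr ℂ N) (a : Gr ℂ N)
    (s : Finset (Fin N)) : L a s = ∑ A, a A * L (Gr.basis A) s := by
  conv_lhs => rw [Gr.sum_smul_basis a]
  simp [Finset.sum_apply]

lemma fermConv_apply_eq_sum (a b : Gr ℂ (2 * n)) (s : Finset (Fin (2 * n))) :
    fermConv n a b s =
      ∑ A, ∑ B, a A * b B * fermConv n (Gr.basis A) (Gr.basis B) s := by
  rw [show fermConv n a b = (fermConv n).flip b a from rfl, linearMap_apply_eq_sum]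
  refine Finset.sum_congr rfl fun A _ => ?_
  rw [LinearMap.flip_apply, linearMap_apply_eq_sum, Finset.mul_sum]
  exact Finset.sum_congr rfl fun B _ => (mul_assoc _ _ _).symm

lemma superFT_eq {σ : ℂ} {f : SF m n} {y : Fin m → ℝ}
    (hf : ∀ s, Integrable fun x => bosK σ x y * f x s) :
    superFT m n σ f y =
      (((2 * Real.pi : ℝ) : ℂ) ^ ((-((m : ℂ) - 2 * (n : ℂ))) / 2)) •
        fermFTₗ n σ (bosFT m n σ f y) := by
  funext s
  rw [Pi.smul_apply, smul_eq_mul, linearMap_apply_eq_sum]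
  change _ * ∫ x, bosK σ x y * fermFTₗ n σ (f x) s = _
  congr 1
  simp only [linearMap_apply_eq_sum _ (f _), Finset.mul_sum, ← mul_assoc]
  rw [integral_finsetSum _ fun A _ => (hf A).mul_const _]
  simp only [integral_mul_const]
  rfl

lemma bosK_mul_conv {σ : ℂ} {f g : SF m n} (y : Fin m → ℝ)
    (hconv : ∀ (s t : Finset (Fin (2 * n))) (u : Fin m → ℝ),
      Integrable (fun x => f (u - x) s * g x t)) (u : Fin m → ℝ) (s : Finset (Fin (2 * n))) :
    bosK σ u y * conv m n f g u s =
      ∑ A, ∑ B, (bosK σ u y * ∫ x, f (u - x) A * g x B) *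
        fermConv n (Gr.basis A) (Gr.basis B) s := by
  change _ * ∫ x, fermConv n (f (u - x)) (g x) s = _
  simp only [fermConv_apply_eq_sum (f _)]
  rw [integral_finsetSum _ fun A _ =>
    integrable_finsetSum _ fun B _ => (hconv A B u).mul_const _, Finset.mul_sum]
  refine Finset.sum_congr rfl fun A _ => ?_
  rw [integral_finsetSum _ fun B _ => (hconv A B u).mul_const _, Finset.mul_sum]
  simp only [integral_mul_const]
  exact Finset.sum_congr rfl fun B _ => (mul_assoc _ _ _).symm

lemma integrable_bosK_mul_conv {σ : ℂ} (hσ : σ = 1 ∨ σ = -1) {f g : SF m n}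
    (hf : ∀ s, Integrable fun x => f x s) (hg : ∀ s, Integrable fun x => g x s)
    (hconv : ∀ (s t : Finset (Fin (2 * n))) (u : Fin m → ℝ),
      Integrable (fun x => f (u - x) s * g x t)) (y : Fin m → ℝ) (s : Finset (Fin (2 * n))) :
    Integrable fun u => bosK σ u y * conv m n f g u s := by
  simp only [bosK_mul_conv y hconv]
  exact integrable_finsetSum _ fun A _ => integrable_finsetSum _ fun B _ =>
    (integrable_bosK_mul_integral hσ y (hf A) (hg B)).mul_const _

lemma bosFT_conv {σ : ℂ} (hσ : σ = 1 ∨ σ = -1) {f g : SF m n}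
    (hf : ∀ s, Integrable fun x => f x s) (hg : ∀ s, Integrable fun x => g x s)
    (hconv : ∀ (s t : Finset (Fin (2 * n))) (u : Fin m → ℝ),
      Integrable (fun x => f (u - x) s * g x t)) (y : Fin m → ℝ) :
    bosFT m n σ (conv m n f g) y = fermConv n (bosFT m n σ f y) (bosFT m n σ g y) := by
  have hI : ∀ (s A B : Finset (Fin (2 * n))), Integrable fun u =>
      (bosK σ u y * ∫ x, f (u - x) A * g x B) * fermConv n (Gr.basis A) (Gr.basis B) s :=
    fun s A B => (integrable_bosK_mul_integral hσ y (hf A) (hg B)).mul_const _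
  funext s
  rw [fermConv_apply_eq_sum]
  change ∫ u, bosK σ u y * conv m n f g u s = _
  simp only [bosK_mul_conv y hconv]
  rw [integral_finsetSum _ fun A _ => integrable_finsetSum _ fun B _ => hI s A B]
  refine Finset.sum_congr rfl fun A _ => ?_
  rw [integral_finsetSum _ fun B _ => hI s A B]
  refine Finset.sum_congr rfl fun B _ => ?_
  rw [integral_mul_const, integral_bosK_mul_integral hσ y (hf A) (hg B)]
  rfl

end Integration

/-- Convolution theorem: for `f, g` with integrable coefficients such that all coefficient
convolutions exist, `F^±_{m|2n}(f ∗ g) = (2π)^{M/2} F^±_{m|2n}(f) F^±_{m|2n}(g)`,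
where `M = m - 2n` (sign `σ = ±1`). -/
theorem superFT_conv (m n : ℕ) (hm : 1 ≤ m) (σ : ℂ) (hσ : σ = 1 ∨ σ = -1)
    (f g : SF m n)
    (hf : ∀ s : Finset (Fin (2 * n)), MeasureTheory.Integrable (fun x => f x s))
    (hg : ∀ s : Finset (Fin (2 * n)), MeasureTheory.Integrable (fun x => g x s))
    (hconv : ∀ (s t : Finset (Fin (2 * n))) (u : (Fin m) → ℝ),
      MeasureTheory.Integrable (fun x => f (u - x) s * g x t)) :
    superFT m n σ (conv m n f g) =
      fun y => (((2 * Real.pi : ℝ) : ℂ) ^ (((m : ℂ) - 2 * (n : ℂ)) / 2)) •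
        Gr.mul (superFT m n σ f y) (superFT m n σ g y) := by
  funext y
  have hpi : ((2 * Real.pi : ℝ) : ℂ) ≠ 0 := by
    exact_mod_cast (mul_pos two_pos Real.pi_pos).ne'
  rw [superFT_eq (integrable_bosK_mul_conv hσ hf hg hconv y), bosFT_conv hσ hf hg hconv,
    fermFTₗ_fermConv, superFT_eq fun s => integrable_bosK_mul hσ y (hf s),
    superFT_eq fun s => integrable_bosK_mul hσ y (hg s), Gr.smul_mul, Gr.mul_smul, smul_smul,
    ← Complex.cpow_add _ _ hpi, neg_div, add_neg_cancel, Complex.cpow_zero, one_smul]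

end
end

section
/- The super Gaussian is invariant under the super Fourier transform: F^±_{m|2n}(exp(x²/2)) = exp(y²/2), where exp(x²/2) = exp(−(x_1²+⋯+x_m²)/2) · Σ_{j=0}^n (x`²)^j/(2^j j!) with x`² = Σ_{j=1}^n x`_{2j−1} x`_{2j}, and likewise in the y variables. -/
open scoped BigOperators
open Finset MeasureTheory

noncomputable section

/-- The complex Grassmann algebra on `N` generators, as a type carrying its ring structure
(`Gr ℂ N` itself unfolds to a function type, whose ring structure is pointwise). -/
def GrAlg (N : ℕ) : Type := Gr ℂ N

namespace GrAlg

variable {N : ℕ}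

instance : AddCommGroup (GrAlg N) := inferInstanceAs (AddCommGroup (Gr ℂ N))

instance : Module ℂ (GrAlg N) := inferInstanceAs (Module ℂ (Gr ℂ N))

/-- The coefficient of `f` at the ordered monomial indexed by `s`. -/
def coeff (f : GrAlg N) (s : Finset (Fin N)) : ℂ := f s

/-- The ordered monomial indexed by `A`. -/
def mono (A : Finset (Fin N)) : GrAlg N := fun s => if s = A then 1 else 0

@[ext] lemma ext {f g : GrAlg N} (h : ∀ s, f.coeff s = g.coeff s) : f = g := funext h

@[simp] lemma coeff_add (f g : GrAlg N) (s) : (f + g).coeff s = f.coeff s + g.coeff s := rfl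

@[simp] lemma coeff_sub (f g : GrAlg N) (s) : (f - g).coeff s = f.coeff s - g.coeff s := rfl

@[simp] lemma coeff_zero (s) : (0 : GrAlg N).coeff s = 0 := rfl

@[simp] lemma coeff_smul (c : ℂ) (f : GrAlg N) (s) : (c • f).coeff s = c * f.coeff s := rfl

lemma coeff_mono (A s : Finset (Fin N)) : (mono A).coeff s = if s = A then 1 else 0 := rfl

lemma coeff_sum {ι : Type*} (t : Finset ι) (f : ι → GrAlg N) (s) :
    (∑ i ∈ t, f i).coeff s = ∑ i ∈ t, (f i).coeff s :=
  Finset.sum_apply s t f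

lemma msign_union_left {A B : Finset (Fin N)} (h : Disjoint A B) (C : Finset (Fin N)) :
    (Gr.msign (A ∪ B) C : ℂ) = Gr.msign A C * Gr.msign B C := by
  rw [Gr.msign, Gr.msign, Gr.msign, ← pow_add, union_product, filter_union,
    card_union_of_disjoint]
  exact disjoint_filter_filter (disjoint_product.2 (Or.inl h))

lemma msign_union_right {B C : Finset (Fin N)} (h : Disjoint B C) (A : Finset (Fin N)) :
    (Gr.msign A (B ∪ C) : ℂ) = Gr.msign A B * Gr.msign A C := by
  rw [Gr.msign, Gr.msign, Gr.msign, ← pow_add, product_union, filter_union,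
    card_union_of_disjoint]
  exact disjoint_filter_filter (disjoint_product.2 (Or.inr h))

lemma msign_eq_one {A B : Finset (Fin N)} (h : ∀ a ∈ A, ∀ b ∈ B, a ≤ b) :
    (Gr.msign A B : ℂ) = 1 := by
  rw [Gr.msign, filter_false_of_mem]
  · simp
  · rintro ⟨a, b⟩ hab
    rw [mem_product] at hab
    exact not_lt.2 (h a hab.1 b hab.2)

lemma msign_swap {A B : Finset (Fin N)} (h : Disjoint A B) (hA : Even A.card) :
    (Gr.msign A B : ℂ) = Gr.msign B A := by
  have hcard : ((A ×ˢ B).filter fun p => p.2 < p.1).card +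
      ((B ×ˢ A).filter fun p => p.2 < p.1).card = A.card * B.card := by
    rw [← card_product, ← card_filter_add_card_filter_not (s := A ×ˢ B) (fun p => p.2 < p.1)]
    congr 1
    refine card_nbij' Prod.swap Prod.swap ?_ ?_ (fun _ _ => rfl) (fun _ _ => rfl)
    · rintro ⟨b, a⟩ hp
      simp only [coe_filter, mem_product, Set.mem_ofPred_eq] at hp
      simp [hp.1, hp.2.le]
    · rintro ⟨a, b⟩ hp
      simp only [coe_filter, mem_product, Set.mem_ofPred_eq, not_lt] at hp
      have hne : a ≠ b := fun hab => disjoint_left.1 h hp.1.1 (hab ▸ hp.1.2)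
      simp [hp.1, lt_of_le_of_ne hp.2 hne]
  have heven := hA.mul_right B.card
  rw [← hcard, Nat.even_add] at heven
  rw [Gr.msign, Gr.msign]
  by_cases he : Even ((A ×ˢ B).filter fun p => p.2 < p.1).card
  · rw [he.neg_one_pow, (heven.1 he).neg_one_pow]
  · rw [(Nat.not_even_iff_odd.1 he).neg_one_pow,
      (Nat.not_even_iff_odd.1 (heven.not.1 he)).neg_one_pow]

instance : Mul (GrAlg N) := ⟨Gr.mul⟩

instance : One (GrAlg N) := ⟨Gr.one⟩

lemma one_eq : (1 : GrAlg N) = mono ∅ := rfl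

lemma coeff_mul (f g : GrAlg N) (s) :
    (f * g).coeff s = ∑ A ∈ s.powerset, Gr.msign A (s \ A) * f.coeff A * g.coeff (s \ A) := rfl

lemma mono_mul_mono {A B : Finset (Fin N)} (h : Disjoint A B) :
    mono A * mono B = (Gr.msign A B : ℂ) • mono (A ∪ B) := by
  ext s
  rw [coeff_mul, coeff_smul, coeff_mono]
  by_cases hs : s = A ∪ B
  · subst hs
    rw [sum_eq_single A]
    · simp [coeff_mono, union_sdiff_cancel_left h]
    · intro C _ hC
      simp [coeff_mono, hC]
    · exact fun hA => absurd (mem_powerset.2 subset_union_left) hA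
  · rw [if_neg hs, mul_zero]
    refine sum_eq_zero fun C hC => ?_
    rw [coeff_mono, coeff_mono]
    split_ifs with h1 h2
    · exact absurd (by rw [← h1, ← h2, union_sdiff_of_subset (mem_powerset.1 hC)]) hs
    all_goals simp

lemma mono_mul_mono_of_lt {A B : Finset (Fin N)} (h : ∀ a ∈ A, ∀ b ∈ B, a < b) :
    mono A * mono B = mono (A ∪ B) := by
  rw [mono_mul_mono (disjoint_left.2 fun a ha hb => lt_irrefl a (h a ha a hb)),
    msign_eq_one fun a ha b hb => (h a ha b hb).le, one_smul]

lemma mono_mul_mono_of_not_disjoint {A B : Finset (Fin N)} (h : ¬ Disjoint A B) :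
    mono A * mono B = 0 := by
  ext s
  rw [coeff_mul, coeff_zero]
  refine sum_eq_zero fun C _ => ?_
  rw [coeff_mono, coeff_mono]
  split_ifs with h1 h2
  · exact absurd (by rw [← h1, ← h2]; exact disjoint_sdiff) h
  all_goals simp

lemma one_mul_aux (f : GrAlg N) : 1 * f = f := by
  ext s
  rw [coeff_mul, sum_eq_single ∅]
  · simp [one_eq, coeff_mono, msign_eq_one]
  · intro C _ hC
    simp [one_eq, coeff_mono, hC]
  · simp

lemma mul_one_aux (f : GrAlg N) : f * 1 = f := by
  ext s
  rw [coeff_mul, sum_eq_single s]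
  · simp [one_eq, coeff_mono, msign_eq_one]
  · intro C hC hCs
    have : s \ C ≠ ∅ := fun h0 =>
      hCs (Subset.antisymm (mem_powerset.1 hC) (sdiff_eq_empty_iff_subset.1 h0))
    simp [one_eq, coeff_mono, this]
  · simp

lemma mul_assoc_aux (f g h : GrAlg N) : f * g * h = f * (g * h) := by
  ext s
  simp only [coeff_mul, mul_sum, sum_mul]
  rw [sum_sigma', sum_sigma']
  refine sum_bij' (fun p _ => ⟨p.2, p.1 \ p.2⟩) (fun p _ => ⟨p.1 ∪ p.2, p.1⟩) ?_ ?_ ?_ ?_ ?_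
  · rintro ⟨A, B⟩ hp
    simp only [mem_sigma, mem_powerset] at hp ⊢
    exact ⟨hp.2.trans hp.1, sdiff_subset_sdiff hp.1 le_rfl⟩
  · rintro ⟨A, B⟩ hp
    simp only [mem_sigma, mem_powerset] at hp ⊢
    exact ⟨union_subset hp.1 (hp.2.trans sdiff_subset), subset_union_left⟩
  · rintro ⟨A, B⟩ hp
    simp only [mem_sigma, mem_powerset] at hp
    simp [union_sdiff_of_subset hp.2]
  · rintro ⟨A, B⟩ hp
    simp only [mem_sigma, mem_powerset] at hp
    have : Disjoint A B := (disjoint_sdiff (s := A) (t := s)).mono_right hp.2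
    simp [union_sdiff_cancel_left this]
  · rintro ⟨A, B⟩ hp
    simp only [mem_sigma, mem_powerset] at hp
    obtain ⟨hA, hB⟩ := hp
    have h1 : (s \ B) \ (A \ B) = s \ A := by
      ext x; have := @hB x; simp only [mem_sdiff]; tauto
    have h2 : s \ B = (A \ B) ∪ (s \ A) := by
      ext x; have := @hB x; have := @hA x; simp only [mem_sdiff, mem_union]; tauto
    have h3 : (Gr.msign A (s \ A) : ℂ) = Gr.msign B (s \ A) * Gr.msign (A \ B) (s \ A) := by
      rw [← msign_union_left disjoint_sdiff, union_sdiff_of_subset hB]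
    have h4 : (Gr.msign B (s \ B) : ℂ) = Gr.msign B (A \ B) * Gr.msign B (s \ A) := by
      rw [h2, msign_union_right (disjoint_sdiff.mono_left sdiff_subset)]
    simp only [h1, h3, h4]
    ring

instance : Ring (GrAlg N) where
  __ := (inferInstance : AddCommGroup (GrAlg N))
  mul_assoc := mul_assoc_aux
  one_mul := one_mul_aux
  mul_one := mul_one_aux
  left_distrib f g h := by ext s; simp [coeff_mul, mul_add, sum_add_distrib]
  right_distrib f g h := by ext s; simp [coeff_mul, mul_add, add_mul, sum_add_distrib]
  zero_mul f := by ext s; simp [coeff_mul]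
  mul_zero f := by ext s; simp [coeff_mul]

instance : Algebra ℂ (GrAlg N) :=
  Algebra.ofModule
    (fun c f g => by
      ext s
      simp only [coeff_mul, coeff_smul, mul_sum]
      exact sum_congr rfl fun _ _ => by ring)
    (fun c f g => by
      ext s
      simp only [coeff_mul, coeff_smul, mul_sum]
      exact sum_congr rfl fun _ _ => by ring)

/-- The identification of `Gr ℂ N` with `GrAlg N`. -/
def ofGr : Gr ℂ N ≃ₗ[ℂ] GrAlg N := LinearEquiv.refl ℂ (Gr ℂ N)

lemma coeff_ofGr (f : Gr ℂ N) (s) : (ofGr f).coeff s = f s := rfl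

lemma ofGr_mul (f g : Gr ℂ N) : ofGr (Gr.mul f g) = ofGr f * ofGr g := rfl

lemma ofGr_pow (f : Gr ℂ N) (k : ℕ) : ofGr (Gr.pow f k) = ofGr f ^ k := by
  induction k with
  | zero => rfl
  | succ k ih => rw [pow_succ, ← ih, Gr.pow, ofGr_mul]

lemma ofGr_gexp (f : Gr ℂ N) :
    ofGr (Gr.gexp f) = ∑ k ∈ range (N + 1), ((k.factorial : ℂ))⁻¹ • ofGr f ^ k := by
  simp only [Gr.gexp, map_sum, map_smul, ofGr_pow]

lemma mono_mem_center {A : Finset (Fin N)} (hA : Even A.card) :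
    mono A ∈ Subalgebra.center ℂ (GrAlg N) := by
  rw [Subalgebra.mem_center_iff]
  intro g
  ext s
  rw [coeff_mul, coeff_mul]
  refine sum_bij' (fun B _ => s \ B) (fun B _ => s \ B) ?_ ?_ ?_ ?_ ?_
  · simp
  · simp
  · intro B hB
    simp [inter_eq_right.2 (mem_powerset.1 hB)]
  · intro B hB
    simp [inter_eq_right.2 (mem_powerset.1 hB)]
  · intro B hB
    simp only [Finset.sdiff_sdiff_eq_self (mem_powerset.1 hB), coeff_mono]
    split_ifs with h
    · have hdisj : Disjoint A B := by rw [← h]; exact sdiff_disjoint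
      rw [h, msign_swap hdisj hA]
      ring
    · simp

/-- The monomial `x_a x_b`, `a < b`, as an element of the centre. -/
def centralPair (a b : Fin N) (h : a < b) : Subalgebra.center ℂ (GrAlg N) :=
  ⟨mono {a, b}, mono_mem_center (by rw [card_pair h.ne]; exact even_two)⟩

lemma ofGr_gen_mul_gen {a b : Fin N} (h : a < b) :
    ofGr (Gr.mul (Gr.gen a) (Gr.gen b)) = (centralPair a b h : GrAlg N) :=
  mono_mul_mono_of_lt (A := {a}) (B := {b}) (by simpa using h)

lemma centralPair_mul_eq_zero {a b c d : Fin N} (h : a < b) (h' : c < d)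
    (hd : ¬ Disjoint ({a, b} : Finset (Fin N)) {c, d}) :
    centralPair a b h * centralPair c d h' = 0 :=
  Subtype.ext (mono_mul_mono_of_not_disjoint hd)

/-- The set of generators `lo j`, `hi j` with `j ∈ S`. -/
def pairSet {n : ℕ} (lo hi : Fin n → Fin N) (S : Finset (Fin n)) : Finset (Fin N) :=
  S.biUnion fun j => {lo j, hi j}

section Pairs

variable {n : ℕ} {lo hi : Fin n → Fin N} (hlt : ∀ j, lo j < hi j)
  (hmono : ∀ j k, j < k → hi j < lo k)

include hmono in
lemma prod_centralPair (S : Finset (Fin n)) :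
    ((∏ j ∈ S, centralPair (lo j) (hi j) (hlt j) : Subalgebra.center ℂ (GrAlg N)) : GrAlg N) =
      mono (pairSet lo hi S) := by
  induction S using Finset.induction_on_max with
  | empty => rfl
  | insert a S ha ih =>
    rw [prod_insert fun h => lt_irrefl a (ha a h), mul_comm, MulMemClass.coe_mul, ih]
    rw [centralPair, mono_mul_mono_of_lt, pairSet, pairSet, biUnion_insert, union_comm]
    intro x hx y hy
    simp only [pairSet, mem_biUnion, mem_insert, mem_singleton] at hx hy
    obtain ⟨j, hj, hx⟩ := hx
    have h1 := hmono j a (ha j hj)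
    have h2 := hlt j
    have h3 := hlt a
    rcases hx with rfl | rfl <;> rcases hy with rfl | rfl <;> order

include hmono in
lemma prod_one_add_centralPair :
    ((∏ j, (1 + (1 / 2 : ℂ) • centralPair (lo j) (hi j) (hlt j)) :
      Subalgebra.center ℂ (GrAlg N)) : GrAlg N) =
      ∑ S : Finset (Fin n), (1 / 2 : ℂ) ^ S.card • mono (pairSet lo hi S) := by
  rw [prod_one_add, powerset_univ, AddSubmonoidClass.coe_finsetSum]
  refine sum_congr rfl fun S _ => ?_
  rw [prod_smul, prod_const, ← prod_centralPair hlt hmono]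
  rfl

end Pairs

/-- The coefficients of `f` vanish at monomials having at least `d` generators in `T`. -/
def DegLT (T : Finset (Fin N)) (d : ℕ) (f : GrAlg N) : Prop :=
  ∀ s : Finset (Fin N), d ≤ (s ∩ T).card → f.coeff s = 0

namespace DegLT

variable {T : Finset (Fin N)} {d e : ℕ} {f g : GrAlg N}

lemma mono_right (hf : DegLT T d f) (h : d ≤ e) : DegLT T e f :=
  fun s hs => hf s (h.trans hs)

lemma add (hf : DegLT T d f) (hg : DegLT T d g) : DegLT T d (f + g) := fun s hs => by
  rw [coeff_add, hf s hs, hg s hs, add_zero]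

lemma smul (c : ℂ) (hf : DegLT T d f) : DegLT T d (c • f) := fun s hs => by
  rw [coeff_smul, hf s hs, mul_zero]

lemma mul (hf : DegLT T (d + 1) f) (hg : DegLT T e g) : DegLT T (d + e) (f * g) := by
  intro s hs
  rw [coeff_mul]
  refine sum_eq_zero fun A hA => ?_
  have hcard : (s ∩ T).card = (A ∩ T).card + ((s \ A) ∩ T).card := by
    rw [← card_union_of_disjoint, ← union_inter_distrib_right,
      union_sdiff_of_subset (mem_powerset.1 hA)]
    exact disjoint_sdiff.mono inter_subset_left inter_subset_left
  by_cases h : d + 1 ≤ (A ∩ T).card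
  · rw [hf A h, mul_zero, zero_mul]
  · rw [hg (s \ A) (by omega), mul_zero]

lemma monomial {A : Finset (Fin N)} (h : (A ∩ T).card < d) : DegLT T d (GrAlg.mono A) := by
  intro s hs
  rw [coeff_mono, if_neg]
  rintro rfl
  omega

lemma one : DegLT T 1 (1 : GrAlg N) := monomial (A := ∅) (by simp)

/-- Modulo elements of lower degree, a product of elements `u j + v j` with `v j` of degree `2` and
`u j` of degree at most `1` is the product of the `v j`. -/
lemma prod_add_sub_prod {ι : Type*} [DecidableEq ι] (S : Finset ι)
    {u v : ι → Subalgebra.center ℂ (GrAlg N)}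
    (hu : ∀ j, DegLT T 2 (u j : GrAlg N)) (hv : ∀ j, DegLT T 3 (v j : GrAlg N)) :
    DegLT T (2 * S.card + 1) ((∏ j ∈ S, (u j + v j) : Subalgebra.center ℂ (GrAlg N)) : GrAlg N) ∧
    DegLT T (2 * S.card) ((∏ j ∈ S, (u j + v j) : Subalgebra.center ℂ (GrAlg N)) -
      (∏ j ∈ S, v j : Subalgebra.center ℂ (GrAlg N)) : GrAlg N) := by
  induction S using Finset.induction_on with
  | empty => exact ⟨one, fun s _ => by simp⟩
  | insert a S ha ih =>
    obtain ⟨ih1, ih2⟩ := ih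
    rw [prod_insert ha, prod_insert ha, card_insert_of_notMem ha]
    simp only [MulMemClass.coe_mul, AddMemClass.coe_add]
    refine ⟨?_, ?_⟩
    · exact (mul ((hu a).mono_right (by omega) |>.add (hv a)) ih1).mono_right (by omega)
    · rw [show ∀ x y z w : GrAlg N, (x + y) * z - y * w = x * z + y * (z - w) by
        intros; noncomm_ring]
      exact ((mul (hu a) ih1).mono_right (by omega)).add ((mul (hv a) ih2).mono_right (by omega))

end DegLT

/-- A list of derivatives along increasing generators, all of them below `s`, reads off a
coefficient without sign. -/
lemma derivList_apply (l : List (Fin N)) (hl : l.Pairwise (· < ·)) (F : Gr ℂ N)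
    (s : Finset (Fin N)) (h : ∀ a ∈ l, ∀ b ∈ s, a < b) :
    Gr.derivList l F s = F (l.toFinset ∪ s) := by
  induction l generalizing F with
  | nil => simp [Gr.derivList]
  | cons a l ih =>
    rw [List.pairwise_cons] at hl
    have ha : ∀ b ∈ l.toFinset ∪ s, a < b := by
      intro b hb
      rcases mem_union.1 hb with hb | hb
      · exact hl.1 b (List.mem_toFinset.1 hb)
      · exact h a (by simp) b hb
    have := ih hl.2 (Gr.pderiv a F) fun c hc => h c (by simp [hc])
    rw [show Gr.derivList (a :: l) F = Gr.derivList l (Gr.pderiv a F) from rfl, this, Gr.pderiv,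
      if_neg fun hmem => lt_irrefl a (ha a hmem),
      filter_false_of_mem fun b hb => (ha b hb).le.not_gt]
    simp

end GrAlg

end

lemma add_pow_succ_of_sq_eq_zero {A : Type*} [CommRing A] (x a : A) (ha : a * a = 0) (k : ℕ) :
    (x + a) ^ (k + 1) = x ^ (k + 1) + (k + 1) * (a * x ^ k) := by
  induction k with
  | zero => simp
  | succ k ih =>
    rw [pow_succ, ih]
    push_cast
    linear_combination ((k : A) + 1) * x ^ k * ha

/-- The exponential of a sum of square-zero elements is the product of their exponentials. -/
lemma sum_inv_factorial_smul_pow_sum {A ι : Type*} [CommRing A] [Algebra ℂ A] [DecidableEq ι]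
    (S : Finset ι) (a : ι → A) (ha : ∀ i, a i * a i = 0) (M : ℕ) (hM : S.card < M) :
    ∑ k ∈ range M, ((k.factorial : ℂ))⁻¹ • (∑ i ∈ S, a i) ^ k = ∏ i ∈ S, (1 + a i) := by
  induction S using Finset.induction_on generalizing M with
  | empty =>
    obtain ⟨M, rfl⟩ := Nat.exists_eq_succ_of_ne_zero (by simpa using hM.ne')
    simp [sum_range_succ']
  | insert i S hi ih =>
    rw [card_insert_of_notMem hi] at hM
    obtain ⟨M, rfl⟩ := Nat.exists_eq_succ_of_ne_zero (by omega : M ≠ 0)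
    have h1 := ih M (by omega)
    have h2 := ih (M + 1) (by omega)
    rw [prod_insert hi, add_mul, one_mul]
    nth_rewrite 1 [← h2]
    rw [← h1, sum_insert hi, sum_range_succ', sum_range_succ', mul_sum, add_right_comm,
      ← sum_add_distrib]
    congr 1
    · refine sum_congr rfl fun k _ => ?_
      have hk : ((k + 1).factorial : ℂ)⁻¹ * (k + 1) = (k.factorial : ℂ)⁻¹ := by
        rw [Nat.factorial_succ]
        push_cast
        field_simp
      rw [add_comm (a i), add_pow_succ_of_sq_eq_zero _ _ (ha i), smul_add, ← hk, mul_smul,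
        mul_smul_comm, mul_smul_comm]
      congr 2
      rw [Algebra.smul_def]
      simp
    · simp

noncomputable section Fermionic

open GrAlg

variable (n : ℕ)

lemma lo_lt_hi (j : Fin n) : lo n j < hi n j := by
  simp [lo, hi]

lemma hi_lt_lo {n : ℕ} (j k : Fin n) (h : j < k) : hi n j < lo n k := by
  simp only [hi, lo, Fin.mk_lt_mk]
  have : (j : ℕ) < k := h
  omega

lemma xi_lt_xi {a b : Fin (2 * n)} : xi n a < xi n b ↔ a < b := by
  exact Iff.rfl

lemma yi_lt_yi {a b : Fin (2 * n)} : yi n a < yi n b ↔ a < b := by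
  simp [yi]

lemma xi_lt_yi (a b : Fin (2 * n)) : xi n a < yi n b := by
  simp only [xi, yi, Fin.lt_def, Fin.val_castAdd, Fin.val_natAdd]
  omega

lemma yi_injective : Function.Injective (yi n) := Fin.natAdd_injective _ _

lemma xi_injective : Function.Injective (xi n) := Fin.castAdd_injective _ _

/-- The set of all `x` generators. -/
def allX : Finset (Fin (2 * n + 2 * n)) := univ.image (xi n)

lemma pairSet_image {N' : ℕ} (φ : Fin (2 * n) → Fin N') (S : Finset (Fin n)) :
    pairSet (fun j => φ (lo n j)) (fun j => φ (hi n j)) S =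
      (pairSet (lo n) (hi n) S).image φ := by
  rw [pairSet, pairSet, biUnion_image]
  exact biUnion_congr rfl fun j _ => by rw [image_insert, image_singleton]

lemma pairSet_univ : pairSet (lo n) (hi n) univ = univ := by
  ext t
  simp only [pairSet, mem_biUnion, mem_univ, true_and, mem_insert, mem_singleton, iff_true]
  refine ⟨⟨t / 2, by omega⟩, ?_⟩
  simp only [lo, hi, Fin.ext_iff]
  omega

lemma fermGauss_eq_prod : ofGr (fermGauss n) =
    ((∏ j, (1 + (1 / 2 : ℂ) • centralPair (lo n j) (hi n j) (lo_lt_hi n j)) :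
      Subalgebra.center ℂ (GrAlg (2 * n))) : GrAlg (2 * n)) := by
  have hx : ofGr (xsq n) =
      ((∑ j, centralPair (lo n j) (hi n j) (lo_lt_hi n j) :
        Subalgebra.center ℂ (GrAlg (2 * n))) : GrAlg (2 * n)) := by
    rw [AddSubmonoidClass.coe_finsetSum, xsq, map_sum]
    exact sum_congr rfl fun j _ => ofGr_gen_mul_gen (lo_lt_hi n j)
  rw [← sum_inv_factorial_smul_pow_sum univ _ _ (n + 1) (by simp), AddSubmonoidClass.coe_finsetSum,
    fermGauss, map_sum]
  · refine sum_congr rfl fun k _ => ?_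
    rw [← smul_sum, smul_pow, smul_smul, map_smul, ofGr_pow, hx]
    rw [mul_inv, mul_comm ((2 : ℂ) ^ k)⁻¹, ← inv_pow, ← one_div 2]
    rfl
  · intro j
    rw [smul_mul_smul_comm, centralPair_mul_eq_zero _ _ (by simp), smul_zero]

lemma fermGauss_eq_sum : ofGr (fermGauss n) =
    ∑ S : Finset (Fin n), (1 / 2 : ℂ) ^ S.card • mono (pairSet (lo n) (hi n) S) := by
  rw [fermGauss_eq_prod, prod_one_add_centralPair _ hi_lt_lo]

/-- `embX` as a linear map. -/
def embXLinear : Gr ℂ (2 * n) →ₗ[ℂ] Gr ℂ (2 * n + 2 * n) where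
  toFun f := embX n f
  map_add' f g := by
    funext s
    simp only [embX, Pi.add_apply, ← sum_add_distrib]
    refine sum_congr rfl fun A _ => ?_
    split_ifs <;> simp
  map_smul' c f := by
    funext s
    simp only [embX, Pi.smul_apply, smul_eq_mul, mul_sum, mul_ite, mul_zero, RingHom.id_apply]

lemma embX_smul (c : ℂ) (f : Gr ℂ (2 * n)) : embX n (c • f) = c • embX n f :=
  (embXLinear n).map_smul c f

lemma ofGr_embX_mono (A : Finset (Fin (2 * n))) :
    ofGr (embXLinear n (ofGr.symm (mono A))) = mono (A.image (xi n)) := by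
  ext s
  change ∑ B : Finset (Fin (2 * n)), (if s = B.image (xi n) then (mono A).coeff B else 0) = _
  rw [sum_eq_single A]
  · simp [coeff_mono]
  · intro B _ hB
    simp [coeff_mono, hB]
  · simp

lemma embX_fermGauss : ofGr (embX n (fermGauss n)) =
    ((∏ j, (1 + (1 / 2 : ℂ) • centralPair (xi n (lo n j)) (xi n (hi n j))
      ((xi_lt_xi n).2 (lo_lt_hi n j))) :
      Subalgebra.center ℂ (GrAlg (2 * n + 2 * n))) : GrAlg (2 * n + 2 * n)) := by
  rw [prod_one_add_centralPair (lo := fun j => xi n (lo n j)) (hi := fun j => xi n (hi n j)) _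
    fun j k h => (xi_lt_xi n).2 (hi_lt_lo j k h)]
  have h : embX n (fermGauss n) = embXLinear n (ofGr.symm (ofGr (fermGauss n))) := rfl
  rw [h, fermGauss_eq_sum]
  simp only [map_sum, map_smul, ofGr_embX_mono]
  exact sum_congr rfl fun S _ => by rw [pairSet_image]

lemma fermK_eq_prod (σ : ℂ) : ofGr (fermK n σ) =
    ((∏ j, ((1 + (-σ * (Complex.I / 2)) • centralPair (xi n (lo n j)) (yi n (hi n j))
        (xi_lt_yi n _ _)) *
      (1 + (σ * (Complex.I / 2)) • centralPair (xi n (hi n j)) (yi n (lo n j))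
        (xi_lt_yi n _ _))) :
      Subalgebra.center ℂ (GrAlg (2 * n + 2 * n))) : GrAlg (2 * n + 2 * n)) := by
  set a : Fin n ⊕ Fin n → Subalgebra.center ℂ (GrAlg (2 * n + 2 * n)) := Sum.elim
    (fun j => (-σ * (Complex.I / 2)) • centralPair (xi n (lo n j)) (yi n (hi n j))
      (xi_lt_yi n _ _))
    (fun j => (σ * (Complex.I / 2)) • centralPair (xi n (hi n j)) (yi n (lo n j))
      (xi_lt_yi n _ _)) with ha
  have hsum : ofGr ((-σ * (Complex.I / 2)) • ∑ j : Fin n,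
      (Gr.mul (Gr.gen (xi n (lo n j))) (Gr.gen (yi n (hi n j))) -
       Gr.mul (Gr.gen (xi n (hi n j))) (Gr.gen (yi n (lo n j))))) =
      ((∑ i, a i : Subalgebra.center ℂ (GrAlg (2 * n + 2 * n))) : GrAlg (2 * n + 2 * n)) := by
    rw [Fintype.sum_sum_type, ← sum_add_distrib, AddSubmonoidClass.coe_finsetSum, map_smul,
      map_sum, smul_sum]
    refine sum_congr rfl fun j _ => ?_
    rw [map_sub, ofGr_gen_mul_gen (xi_lt_yi n _ _), ofGr_gen_mul_gen (xi_lt_yi n _ _), smul_sub,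
      sub_eq_add_neg, ← neg_smul, neg_mul, neg_neg, ha, Sum.elim_inl, Sum.elim_inr, neg_mul]
    rfl
  have hprod : (∏ j, ((1 + (-σ * (Complex.I / 2)) • centralPair (xi n (lo n j)) (yi n (hi n j))
        (xi_lt_yi n _ _)) *
      (1 + (σ * (Complex.I / 2)) • centralPair (xi n (hi n j)) (yi n (lo n j))
        (xi_lt_yi n _ _)))) = ∏ i, (1 + a i) := by
    rw [Fintype.prod_sum_type, ← prod_mul_distrib]
    rfl
  rw [hprod, ← sum_inv_factorial_smul_pow_sum univ a _ (2 * n + 2 * n + 1)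
    (by simp; omega), AddSubmonoidClass.coe_finsetSum, fermK, ofGr_gexp, hsum]
  · rfl
  · rintro (j | j) <;>
    · simp only [ha, Sum.elim_inl, Sum.elim_inr]
      rw [smul_mul_smul_comm, centralPair_mul_eq_zero _ _ (by simp), smul_zero]

lemma mixed_pair_mul (j : Fin n) :
    centralPair (xi n (lo n j)) (yi n (hi n j)) (xi_lt_yi n _ _) *
      centralPair (xi n (hi n j)) (yi n (lo n j)) (xi_lt_yi n _ _) =
    centralPair (xi n (lo n j)) (xi n (hi n j)) ((xi_lt_xi n).2 (lo_lt_hi n j)) *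
      centralPair (yi n (lo n j)) (yi n (hi n j)) ((yi_lt_yi n).2 (lo_lt_hi n j)) := by
  have hx := (xi_lt_xi n).2 (lo_lt_hi n j)
  have hy := (yi_lt_yi n).2 (lo_lt_hi n j)
  have h1 := xi_lt_yi n (lo n j) (hi n j)
  have h2 := xi_lt_yi n (hi n j) (lo n j)
  have h3 := xi_lt_yi n (lo n j) (lo n j)
  have h4 := xi_lt_yi n (hi n j) (hi n j)
  apply Subtype.ext
  simp only [MulMemClass.coe_mul, centralPair]
  generalize xi n (lo n j) = a at *
  generalize xi n (hi n j) = b at *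
  generalize yi n (lo n j) = c at *
  generalize yi n (hi n j) = d at *
  rw [mono_mul_mono_of_lt (A := {a, b}), mono_mul_mono]
  · have hsign : (Gr.msign {a, d} {b, c} : ℂ) = 1 := by
      have hset : ((({a, d} : Finset _) ×ˢ ({b, c} : Finset _)).filter fun p => p.2 < p.1) =
          {(d, b), (d, c)} := by
        ext ⟨p, q⟩
        simp only [mem_filter, mem_product, mem_insert, mem_singleton, Prod.mk.injEq]
        constructor
        · rintro ⟨⟨rfl | rfl, rfl | rfl⟩, h⟩
          · exact absurd h hx.not_gt
          · exact absurd h h3.not_gt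
          · simp
          · simp
        · rintro (⟨rfl, rfl⟩ | ⟨rfl, rfl⟩) <;> simp [h4, hy]
      rw [Gr.msign, hset, card_pair (by simp [h2.ne])]
      norm_num
    rw [hsign, one_smul]
    congr 1
    ext x
    simp only [mem_union, mem_insert, mem_singleton]
    tauto
  · simp [hx.ne', h4.ne, h3.ne', hy.ne]
  · simp [h1, h2, h3, h4]

lemma local_factor {A : Type*} [CommRing A] {k h a b p q : A} (hk : k * k = -(h * h))
    (hab : a * b = p * q) (hap : a * p = 0) (hbp : b * p = 0) :
    (1 + -k * a) * (1 + k * b) * (1 + h * p) =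
      (1 + -k * a + k * b) + h * p * (1 + h * q) := by
  linear_combination -(k * h) * hap + (k * h - k * k * h * a) * hbp -
    a * b * hk + h * h * hab

lemma fermK_mul_embX_fermGauss (σ : ℂ) (hσ : σ = 1 ∨ σ = -1) (s : Finset (Fin (2 * n))) :
    Gr.mul (fermK n σ) (embX n (fermGauss n)) (allX n ∪ s.image (yi n)) =
      (1 / 2) ^ n * fermGauss n s := by
  set u : Fin n → Subalgebra.center ℂ (GrAlg (2 * n + 2 * n)) := fun j =>
    1 + (-σ * (Complex.I / 2)) • centralPair (xi n (lo n j)) (yi n (hi n j)) (xi_lt_yi n _ _) +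
      (σ * (Complex.I / 2)) • centralPair (xi n (hi n j)) (yi n (lo n j)) (xi_lt_yi n _ _) with hu
  set p : Fin n → Subalgebra.center ℂ (GrAlg (2 * n + 2 * n)) := fun j =>
    centralPair (xi n (lo n j)) (xi n (hi n j)) ((xi_lt_xi n).2 (lo_lt_hi n j)) with hp
  set q : Fin n → Subalgebra.center ℂ (GrAlg (2 * n + 2 * n)) := fun j =>
    centralPair (yi n (lo n j)) (yi n (hi n j)) ((yi_lt_yi n).2 (lo_lt_hi n j)) with hq
  set v : Fin n → Subalgebra.center ℂ (GrAlg (2 * n + 2 * n)) := fun j =>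
    (1 / 2 : ℂ) • p j * (1 + (1 / 2 : ℂ) • q j) with hv
  have hmul : ofGr (fermK n σ) * ofGr (embX n (fermGauss n)) =
      ((∏ j, (u j + v j) : Subalgebra.center ℂ (GrAlg (2 * n + 2 * n))) : GrAlg _) := by
    rw [fermK_eq_prod, embX_fermGauss, ← MulMemClass.coe_mul, ← prod_mul_distrib]
    congr 1
    refine prod_congr rfl fun j _ => ?_
    simp only [hu, hv, hp, hq, Algebra.smul_def, neg_mul, map_neg]
    refine local_factor ?_ (mixed_pair_mul n j) (centralPair_mul_eq_zero _ _ (by simp))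
      (centralPair_mul_eq_zero _ _ (by simp))
    have h1 : σ * σ = 1 := by rcases hσ with rfl | rfl <;> norm_num
    have h2 : σ * (Complex.I / 2) * (σ * (Complex.I / 2)) = -(1 / 2 * (1 / 2)) := by
      linear_combination Complex.I * Complex.I / 4 * h1 + Complex.I_mul_I / 4
    rw [← map_mul, ← map_mul, h2]
    exact map_neg (algebraMap ℂ (Subalgebra.center ℂ (GrAlg (2 * n + 2 * n)))) _
  have hcard : (allX n).card = 2 * n := by
    rw [allX, card_image_of_injective _ (xi_injective n), card_univ, Fintype.card_fin]
  have hx : ∀ a, xi n a ∈ allX n := fun a => mem_image_of_mem _ (mem_univ a)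
  have hy : ∀ a, yi n a ∉ allX n := fun a => by
    simp only [allX, mem_image, mem_univ, true_and, not_exists]
    exact fun b => (xi_lt_yi n b a).ne
  have hone : ∀ a b, (({xi n a, yi n b} : Finset _) ∩ allX n).card < 2 := by
    intro a b
    rw [insert_inter_of_mem (hx a), singleton_inter_of_notMem (hy b)]
    simp
  have hudeg : ∀ j, DegLT (allX n) 2 (u j : GrAlg _) := fun j =>
    ((DegLT.one.mono_right one_le_two).add
      ((DegLT.monomial (hone _ _)).smul _)).add
      ((DegLT.monomial (hone _ _)).smul _)
  have hvdeg : ∀ j, DegLT (allX n) 3 (v j : GrAlg _) := by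
    intro j
    refine DegLT.mul (d := 2) (e := 1) ((DegLT.monomial ?_).smul _)
      (DegLT.one.add ((DegLT.monomial ?_).smul _))
    · exact (card_le_card inter_subset_left).trans_lt (card_le_two.trans_lt (by norm_num))
    · rw [insert_inter_of_notMem (hy _), singleton_inter_of_notMem (hy _)]
      simp
  have hvprod : ((∏ j, v j : Subalgebra.center ℂ (GrAlg (2 * n + 2 * n))) : GrAlg _) =
      (1 / 2 : ℂ) ^ n • ∑ S : Finset (Fin n), (1 / 2 : ℂ) ^ S.card •
        mono (allX n ∪ (pairSet (lo n) (hi n) S).image (yi n)) := by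
    rw [hv, prod_mul_distrib, prod_smul, prod_const, card_univ, Fintype.card_fin,
      smul_mul_assoc]
    change (1 / 2 : ℂ) ^ n • ((∏ j, p j : Subalgebra.center ℂ (GrAlg (2 * n + 2 * n))) *
      (∏ j, (1 + (1 / 2 : ℂ) • q j) : Subalgebra.center ℂ (GrAlg (2 * n + 2 * n))) :
        GrAlg (2 * n + 2 * n)) = _
    rw [hp, prod_centralPair (lo := fun j => xi n (lo n j)) (hi := fun j => xi n (hi n j)) _
        (fun j k h => (xi_lt_xi n).2 (hi_lt_lo j k h)), hq,
      prod_one_add_centralPair (lo := fun j => yi n (lo n j)) (hi := fun j => yi n (hi n j)) _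
        (fun j k h => (yi_lt_yi n).2 (hi_lt_lo j k h)), mul_sum, pairSet_image, pairSet_univ]
    congr 1
    refine sum_congr rfl fun S _ => ?_
    rw [mul_smul_comm, pairSet_image, mono_mul_mono_of_lt, allX]
    intro a ha b hb
    obtain ⟨a, -, rfl⟩ := mem_image.1 ha
    obtain ⟨b, -, rfl⟩ := mem_image.1 hb
    exact xi_lt_yi n a b
  have hinj : ∀ t : Finset (Fin (2 * n)),
      allX n ∪ s.image (yi n) = allX n ∪ t.image (yi n) ↔ s = t := by
    intro t
    refine ⟨fun h => ?_, fun h => h ▸ rfl⟩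
    ext a
    have := Finset.ext_iff.1 h (yi n a)
    simpa [hy, (yi_injective n).eq_iff] using this
  have htop := (DegLT.prod_add_sub_prod univ hudeg hvdeg).2 (allX n ∪ s.image (yi n)) (by
    rw [inter_eq_right.2 subset_union_left, hcard, card_univ, Fintype.card_fin])
  rw [coeff_sub, sub_eq_zero, ← hmul, ← ofGr_mul, coeff_ofGr, hvprod] at htop
  refine htop.trans ?_
  rw [coeff_smul, coeff_sum, ← coeff_ofGr (fermGauss n), fermGauss_eq_sum, coeff_sum]
  congr 1
  refine sum_congr rfl fun S _ => ?_
  simp only [coeff_smul, coeff_mono, hinj]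

lemma berezinX_apply (F : Gr ℂ (2 * n + 2 * n)) (s : Finset (Fin (2 * n))) :
    berezinX n F (s.image (yi n)) =
      ((Real.pi : ℂ) ^ n)⁻¹ * F (allX n ∪ s.image (yi n)) := by
  rw [berezinX, Pi.smul_apply, smul_eq_mul, derivList_apply]
  · congr 2
  · rw [List.pairwise_map]
    exact (List.pairwise_lt_finRange _).imp fun h => (xi_lt_xi n).2 h
  · intro a ha b hb
    obtain ⟨a, -, rfl⟩ := List.mem_map.1 ha
    obtain ⟨b, -, rfl⟩ := mem_image.1 hb
    exact xi_lt_yi n a b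

lemma berezinX_fermK_mul_smul_fermGauss (σ : ℂ) (hσ : σ = 1 ∨ σ = -1) (c : ℂ)
    (s : Finset (Fin (2 * n))) :
    berezinX n (Gr.mul (fermK n σ) (embX n (c • fermGauss n))) (s.image (yi n)) =
      c * (((2 * Real.pi : ℂ) ^ n)⁻¹ * fermGauss n s) := by
  have h : Gr.mul (fermK n σ) (embX n (c • fermGauss n)) =
      c • Gr.mul (fermK n σ) (embX n (fermGauss n)) := by
    apply ofGr.injective
    rw [embX_smul, ofGr_mul, map_smul, map_smul, ofGr_mul, mul_smul_comm]
  rw [berezinX_apply, h, Pi.smul_apply, fermK_mul_embX_fermGauss n σ hσ, smul_eq_mul, mul_pow,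
    mul_inv, one_div, inv_pow]
  ring

end Fermionic

lemma integral_fourier_gaussian (m : ℕ) (σ : ℂ) (hσ : σ = 1 ∨ σ = -1) (y : Fin m → ℝ) :
    ∫ x : Fin m → ℝ, Complex.exp (σ * Complex.I * ∑ i, (x i : ℂ) * (y i : ℂ)) *
      ((Real.exp (-(∑ i, (x i) ^ 2) / 2) : ℝ) : ℂ) =
    (2 * Real.pi : ℂ) ^ ((m : ℂ) / 2) * ((Real.exp (-(∑ i, (y i) ^ 2) / 2) : ℝ) : ℂ) := by
  have h := GaussianFourier.integral_cexp_neg_mul_sum_add (b := 1 / 2) (by norm_num)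
    (fun i => σ * Complex.I * (y i : ℂ))
  have h1 : σ * σ = 1 := by rcases hσ with rfl | rfl <;> norm_num
  rw [Fintype.card_fin] at h
  convert h using 1
  · congr 1
    funext x
    rw [Complex.ofReal_exp, ← Complex.exp_add]
    congr 1
    push_cast
    rw [mul_sum, add_comm]
    congr 1
    · ring
    · exact sum_congr rfl fun i _ => by ring
  · rw [Complex.ofReal_exp]
    congr 2
    · ring
    · push_cast
      have : ∀ i, (σ * Complex.I * (y i : ℂ)) ^ 2 = -(y i : ℂ) ^ 2 := fun i => by
        linear_combination (Complex.I * Complex.I * (y i : ℂ) ^ 2) * h1 +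
          (y i : ℂ) ^ 2 * Complex.I_mul_I
      simp only [this, sum_neg_distrib]
      ring

/-- The super Gaussian `exp(x²/2) = exp(-(x_1²+⋯+x_m²)/2) Σ_{j=0}^n (x`²)^j/(2^j j!)` is
invariant under the super Fourier transform (sign `σ = ±1`):
`F^±_{m|2n}(exp(x²/2)) = exp(y²/2)`. -/
theorem superFT_gauss (m n : ℕ) (hm : 1 ≤ m) (σ : ℂ) (hσ : σ = 1 ∨ σ = -1) :
    superFT m n σ (gaussFun m n) = gaussFun m n := by
  funext y s
  simp only [superFT, gaussFun, berezinX_fermK_mul_smul_fermGauss n σ hσ, ← mul_assoc]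
  simp only [mul_assoc _ (((2 * Real.pi : ℂ) ^ n)⁻¹) (fermGauss n s)]
  rw [integral_mul_const, integral_fourier_gaussian m σ hσ y, Pi.smul_apply, smul_eq_mul]
  have hpi : (2 * Real.pi : ℂ) ≠ 0 := by simp [Real.pi_ne_zero]
  have hpow : (2 * Real.pi : ℂ) ^ ((-((m : ℂ) - 2 * (n : ℂ))) / 2) *
      (2 * Real.pi : ℂ) ^ ((m : ℂ) / 2) = (2 * Real.pi : ℂ) ^ n := by
    rw [← Complex.cpow_add _ _ hpi, ← Complex.cpow_natCast]
    congr 1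
    ring
  push_cast
  rw [← mul_assoc, ← mul_assoc, ← mul_assoc, hpow]
  field_simp
end
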